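/- arXiv:1305.7242 — 6 statements merged into one kernel-verified Lean document; each statement's English description precedes it below -/
import Mathlib

section
/- Let P_N denote probabilities for the multi-stage random walk excited by its recent history with history window N and thresholds M_1 < ⋯ < M_l satisfying M_i/N → r_i, and assume the maximum over i ∈ {0,…,l} with r_i < p_i < r_{i+1} of (1/( p_i^{r_i} (1−p_i)^{1−r_i} )) ∏_{k=1}^{i} (p_{k−1}/(1−p_{k−1}))^{r_k − r_{k−1}} is attained at a unique index i_0 (with r_0 = 0, r_{l+1} = 1). Then there exist deterministic times T_N → ∞ such that the shifted increment process converges weakly to the simple random walk with right-jump probability p_{i_0}: for every m ≥ 1 and every (e_1,…,e_m) ∈ {−1,1}^m, lim_{N→∞} P_N( X_{N+T_N+1} − X_{N+T_N} = e_1, …, X_{N+T_N+m} − X_{N+T_N+m−1} = e_m ) = p_{i_0}^{#{i : e_i = 1}} (1 − p_{i_0})^{#{i : e_i = −1}}. -/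
open Filter Finset MeasureTheory Topology

/-- The index `i` of the threshold stage corresponding to `c` right-jumps among the
`N` most recent jumps: the largest `i ∈ {0,…,l}` with `M i ≤ c`. -/
def stage (l : ℕ) (M : ℕ → ℕ) (c : ℕ) : ℕ :=
  ((Finset.range (l + 1)).filter (fun i => M i ≤ c)).sup id

/-- The probability that the `n`-th increment of the multi-stage random walk excited
by its recent history agrees with `e n`, given that the previous increments agree
with `e`.  Here `e k = true` encodes a jump `+1` at time `k`. -/
noncomputable def stepProbMulti (N l : ℕ) (M : ℕ → ℕ) (p : ℕ → ℝ)
    (e : ℕ → Bool) (n : ℕ) : ℝ :=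
  let q : ℝ :=
    if n < N then p 0
    else p (stage l M (((Finset.Ico (n - N) n).filter (fun k => e k = true)).card))
  if e n then q else 1 - q

/-- The quantity `J_i = (1/(pᵢ^{rᵢ}(1-pᵢ)^{1-rᵢ})) ∏_{k=1}^{i} (p_{k-1}/(1-p_{k-1}))^{r_k - r_{k-1}}`. -/
noncomputable def Jfun (p r : ℕ → ℝ) (i : ℕ) : ℝ :=
  (1 / (p i ^ (r i) * (1 - p i) ^ (1 - r i))) *
    ∏ k ∈ Finset.Icc 1 i, (p (k - 1) / (1 - p (k - 1))) ^ (r k - r (k - 1))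


/-- The sequence `b, e 0, e 1, …`. -/
def consSeq (b : Bool) (e : ℕ → Bool) : ℕ → Bool
  | 0 => b
  | k + 1 => e k

/-- The sequence whose first `n` entries are the indicator of `A`, followed by `e`. -/
def blockSeq (A : Finset ℕ) (n : ℕ) (e : ℕ → Bool) : ℕ → Bool :=
  fun k => if k < n then decide (k ∈ A) else e (k - n)

/-- The probability of the outcome `b` of a Bernoulli variable with parameter `q`. -/
noncomputable def bitProb (q : ℝ) (b : Bool) : ℝ := if b then q else 1 - q

/-- The number of `true` entries of `e` among the `N` positions starting at `n`. -/
def windowCount (N : ℕ) (e : ℕ → Bool) (n : ℕ) : ℕ :=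
  ((Finset.Ico n (n + N)).filter (fun k => e k = true)).card

/-- The probability that the `n` entries starting at time `t` agree with `e`. -/
noncomputable def cylProb (μ : Measure (ℕ → Bool)) (t n : ℕ) (e : ℕ → Bool) : ℝ :=
  (μ {ω | ∀ k < n, ω (t + k) = e k}).toReal

/-- After the first `N` entries, the conditional probability of `true` given the past is
`f c`, where `c` is the number of `true` entries among the `N` most recent ones. -/
def IsWindowChain (N : ℕ) (f : ℕ → ℝ) (μ : Measure (ℕ → Bool)) : Prop :=
  ∀ j e, cylProb μ 0 (N + j + 1) e =
    cylProb μ 0 (N + j) e * bitProb (f (windowCount N e j)) (e (N + j))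

lemma measurableSet_cyl (t n : ℕ) (e : ℕ → Bool) :
    MeasurableSet {ω : ℕ → Bool | ∀ k < n, ω (t + k) = e k} := by
  have : {ω : ℕ → Bool | ∀ k < n, ω (t + k) = e k} =
      ⋂ k ∈ Set.Iio n, (fun ω : ℕ → Bool => ω (t + k)) ⁻¹' {e k} := by
    ext ω; simp
  rw [this]
  exact MeasurableSet.biInter (Set.to_countable _) fun k _ =>
    measurable_pi_apply (t + k) (measurableSet_singleton _)

lemma cylProb_nonneg (μ : Measure (ℕ → Bool)) (t n : ℕ) (e : ℕ → Bool) :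
    0 ≤ cylProb μ t n e := ENNReal.toReal_nonneg

lemma cylProb_congr (μ : Measure (ℕ → Bool)) (t n : ℕ) {e e' : ℕ → Bool}
    (h : ∀ k < n, e k = e' k) : cylProb μ t n e = cylProb μ t n e' := by
  unfold cylProb
  congr 2
  ext ω
  exact forall₂_congr fun k hk => by rw [h k hk]

lemma windowCount_congr (N n : ℕ) {e e' : ℕ → Bool}
    (h : ∀ k, n ≤ k → k < n + N → e k = e' k) : windowCount N e n = windowCount N e' n := by
  unfold windowCount
  congr 1
  apply Finset.filter_congr
  intro k hk
  rw [Finset.mem_Ico] at hk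
  rw [h k hk.1 hk.2]

lemma windowCount_le (N n : ℕ) (e : ℕ → Bool) : windowCount N e n ≤ N :=
  (Finset.card_filter_le _ _).trans (by simp)

lemma windowCount_eq_sum (N n : ℕ) (e : ℕ → Bool) :
    windowCount N e n = ∑ k ∈ Finset.range N, (e (n + k)).toNat := by
  unfold windowCount
  rw [Finset.card_filter, Finset.sum_Ico_eq_sum_range]
  simp only [add_tsub_cancel_left]
  refine Finset.sum_congr rfl fun k _ => ?_
  cases e (n + k) <;> simp

lemma windowCount_consSeq (N n : ℕ) (b : Bool) (e : ℕ → Bool) :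
    windowCount N (consSeq b e) (n + 1) = windowCount N e n := by
  rw [windowCount_eq_sum, windowCount_eq_sum]
  refine Finset.sum_congr rfl fun k _ => ?_
  rw [show n + 1 + k = (n + k) + 1 by ring]
  rfl

lemma windowCount_succ_consSeq (n : ℕ) (b : Bool) (e : ℕ → Bool) :
    windowCount (n + 1) (consSeq b e) 0 = windowCount n e 0 + b.toNat := by
  rw [windowCount_eq_sum, windowCount_eq_sum, Finset.sum_range_succ']
  simp [consSeq]

lemma windowCount_succ (n : ℕ) (e : ℕ → Bool) :
    windowCount (n + 1) e 0 = windowCount n e 0 + (e n).toNat := by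
  rw [windowCount_eq_sum, windowCount_eq_sum, Finset.sum_range_succ]
  simp

lemma windowCount_blockSeq {N : ℕ} {A : Finset ℕ} (hA : A ⊆ Finset.range N) (e : ℕ → Bool) :
    windowCount N (blockSeq A N e) 0 = A.card := by
  unfold windowCount
  congr 1
  ext k
  have := @hA k
  simp only [Finset.mem_range] at this
  by_cases hk : k < N
  · simp [blockSeq, hk]
  · simp [blockSeq, hk]
    tauto

lemma cylProb_succ_left (μ : Measure (ℕ → Bool)) [IsProbabilityMeasure μ] (t n : ℕ)
    (e : ℕ → Bool) : cylProb μ (t + 1) n e =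
      cylProb μ t (n + 1) (consSeq true e) + cylProb μ t (n + 1) (consSeq false e) := by
  unfold cylProb
  rw [← ENNReal.toReal_add (measure_ne_top _ _) (measure_ne_top _ _),
    ← measure_union _ (measurableSet_cyl _ _ _)]
  · congr 2
    ext ω
    have h : ∀ b, (∀ k < n + 1, ω (t + k) = consSeq b e k) ↔
        (ω t = b ∧ ∀ k < n, ω (t + 1 + k) = e k) := by
      intro b
      rw [Nat.forall_lt_succ_left']
      simp only [consSeq, add_zero]
      refine and_congr Iff.rfl (forall₂_congr fun k _ => ?_)
      rw [show t + (k + 1) = t + 1 + k by ring]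
    simp only [Set.mem_ofPred_eq, Set.mem_union, h]
    cases ω t <;> simp
  · rw [Set.disjoint_left]
    intro ω h1 h2
    have h1 := h1 0 (by omega)
    have h2 := h2 0 (by omega)
    simp [consSeq] at h1 h2
    simp [h1] at h2

lemma cylProb_add_left (μ : Measure (ℕ → Bool)) [IsProbabilityMeasure μ] (t n m : ℕ)
    (e : ℕ → Bool) : cylProb μ (t + n) m e =
      ∑ A ∈ (Finset.range n).powerset, cylProb μ t (n + m) (blockSeq A n e) := by
  induction n generalizing m e with
  | zero =>
    have : blockSeq ∅ 0 e = e := by funext k; simp [blockSeq]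
    simp [this]
  | succ n ih =>
    rw [← add_assoc, cylProb_succ_left, ih, ih, Finset.range_add_one,
      Finset.sum_powerset_insert (by simp), add_comm]
    congr 1
    all_goals
      refine Finset.sum_congr rfl fun A hA => ?_
      rw [show n + (m + 1) = n + 1 + m by ring]
      apply cylProb_congr
      intro k hk
      have hn : n ∉ A := fun h => by simpa using (Finset.mem_powerset.1 hA) h
      unfold blockSeq
      rcases lt_trichotomy k n with h | rfl | h
      · simp [h, h.trans (Nat.lt_succ_self n), h.ne]
      · simp [consSeq, hn]
      · obtain ⟨d, rfl⟩ := Nat.exists_eq_add_of_lt h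
        rw [if_neg (by omega), if_neg (by omega), show n + d + 1 - n = d + 1 by omega,
          show n + d + 1 - (n + 1) = d by omega]
        rfl

lemma cylProb_zero (μ : Measure (ℕ → Bool)) [IsProbabilityMeasure μ] (t : ℕ) (e : ℕ → Bool) :
    cylProb μ t 0 e = 1 := by
  simp [cylProb]

lemma cylProb_le_one (μ : Measure (ℕ → Bool)) [IsProbabilityMeasure μ] (t n : ℕ)
    (e : ℕ → Bool) : cylProb μ t n e ≤ 1 :=
  ENNReal.toReal_le_of_le_ofReal zero_le_one (by simpa using prob_le_one)

lemma sum_cylProb (μ : Measure (ℕ → Bool)) [IsProbabilityMeasure μ] (t n : ℕ) (e : ℕ → Bool) :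
    ∑ A ∈ (Finset.range n).powerset, cylProb μ t n (blockSeq A n e) = 1 := by
  simpa [cylProb_zero] using (cylProb_add_left μ t n 0 e).symm

namespace IsWindowChain

variable {N : ℕ} {f : ℕ → ℝ} {μ : Measure (ℕ → Bool)} [IsProbabilityMeasure μ]

lemma cylProb_succ (h : IsWindowChain N f μ) (t j : ℕ) (e : ℕ → Bool) :
    cylProb μ t (N + j + 1) e =
      cylProb μ t (N + j) e * bitProb (f (windowCount N e j)) (e (N + j)) := by
  induction t generalizing j e with
  | zero => exact h j e
  | succ t ih =>
    have key : ∀ b, cylProb μ t (N + j + 1 + 1) (consSeq b e) =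
        cylProb μ t (N + j + 1) (consSeq b e) *
          bitProb (f (windowCount N e j)) (e (N + j)) := by
      intro b
      have := ih (j + 1) (consSeq b e)
      rw [windowCount_consSeq] at this
      exact this
    rw [cylProb_succ_left, cylProb_succ_left, key, key]
    ring

lemma cylProb_add (h : IsWindowChain N f μ) (t m : ℕ) (e : ℕ → Bool) :
    cylProb μ t (N + m) e = cylProb μ t N e *
      ∏ j ∈ Finset.range m, bitProb (f (windowCount N e j)) (e (N + j)) := by
  induction m with
  | zero => simp
  | succ m ih => rw [← add_assoc, h.cylProb_succ, ih, Finset.prod_range_succ]; ring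

end IsWindowChain

lemma bitProb_nonneg {q : ℝ} (h0 : 0 ≤ q) (h1 : q ≤ 1) (b : Bool) : 0 ≤ bitProb q b := by
  cases b <;> simp [bitProb] <;> linarith

lemma bitProb_le_one {q : ℝ} (h0 : 0 ≤ q) (h1 : q ≤ 1) (b : Bool) : bitProb q b ≤ 1 := by
  cases b <;> simp [bitProb] <;> linarith

lemma le_bitProb {q δ : ℝ} (h0 : δ ≤ q) (h1 : q ≤ 1 - δ) (b : Bool) : δ ≤ bitProb q b := by
  cases b <;> simp [bitProb] <;> linarith

/-- The product of the odds `f s / (1 - f s)` over `s < c`. -/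
noncomputable def oddsProd (f : ℕ → ℝ) (c : ℕ) : ℝ :=
  ∏ s ∈ Finset.range c, f s / (1 - f s)

/-- Unnormalized stationary weight of a window with `c` entries `true`. -/
noncomputable def windowWeight (f : ℕ → ℝ) (c : ℕ) : ℝ := oddsProd f c / (1 - f c)

lemma oddsProd_pos {f : ℕ → ℝ} (h0 : ∀ c, 0 < f c) (h1 : ∀ c, f c < 1) (c : ℕ) :
    0 < oddsProd f c :=
  Finset.prod_pos fun s _ => div_pos (h0 s) (sub_pos.2 (h1 s))

lemma windowWeight_pos {f : ℕ → ℝ} (h0 : ∀ c, 0 < f c) (h1 : ∀ c, f c < 1) (c : ℕ) :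
    0 < windowWeight f c :=
  div_pos (oddsProd_pos h0 h1 c) (sub_pos.2 (h1 c))

lemma windowWeight_symm {f : ℕ → ℝ} (h1 : ∀ c, f c < 1) (s : ℕ) (b y : Bool) :
    windowWeight f (s + b.toNat) * bitProb (f (s + b.toNat)) y =
      windowWeight f (s + y.toNat) * bitProb (f (s + y.toNat)) b := by
  have hs := (sub_pos.2 (h1 s)).ne'
  have hs' := (sub_pos.2 (h1 (s + 1))).ne'
  cases b <;> cases y <;>
    simp [windowWeight, bitProb, oddsProd, Finset.prod_range_succ] <;> field_simp

namespace IsWindowChain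

variable {N : ℕ} {f : ℕ → ℝ} {μ : Measure (ℕ → Bool)} [IsProbabilityMeasure μ]

lemma cylProb_window_succ {n : ℕ} (h : IsWindowChain (n + 1) f μ) (t : ℕ) (e : ℕ → Bool) :
    cylProb μ (t + 1) (n + 1) e = ∑ b : Bool, cylProb μ t (n + 1) (consSeq b e) *
      bitProb (f (windowCount n e 0 + b.toNat)) (e n) := by
  have key : ∀ b, cylProb μ t (n + 1 + 1) (consSeq b e) = cylProb μ t (n + 1) (consSeq b e) *
      bitProb (f (windowCount n e 0 + b.toNat)) (e n) := by
    intro b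
    have := h.cylProb_succ t 0 (consSeq b e)
    rw [windowCount_succ_consSeq] at this
    exact this
  rw [cylProb_succ_left, key, key, Fintype.sum_bool]

/-- Bounds relative to the stationary weight propagate through the time-reversed kernel. -/
lemma cylProb_window_succ_le {n : ℕ} (h : IsWindowChain (n + 1) f μ)
    (h0 : ∀ c, 0 < f c) (h1 : ∀ c, f c < 1) (t : ℕ) (e : ℕ → Bool) (K : Bool → ℝ)
    (hK : ∀ b, cylProb μ t (n + 1) (consSeq b e) ≤
      K b * windowWeight f (windowCount (n + 1) (consSeq b e) 0)) :
    cylProb μ (t + 1) (n + 1) e ≤ (∑ b : Bool, K b * bitProb (f (windowCount (n + 1) e 0)) b) *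
      windowWeight f (windowCount (n + 1) e 0) := by
  rw [h.cylProb_window_succ, Finset.sum_mul]
  refine Finset.sum_le_sum fun b _ => ?_
  have hb := hK b
  rw [windowCount_succ_consSeq] at hb
  refine (mul_le_mul_of_nonneg_right hb
    (bitProb_nonneg (h0 _).le (h1 _).le _)).trans (le_of_eq ?_)
  rw [mul_assoc, windowWeight_symm h1, ← windowCount_succ]
  ring

lemma cylProb_contract {n : ℕ} (h : IsWindowChain (n + 1) f μ) {δ : ℝ} (hδ : 0 < δ)
    (h0 : ∀ c, δ ≤ f c) (h1 : ∀ c, f c ≤ 1 - δ) (t : ℕ) {K κ : ℝ} (hκ : κ ≤ K)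
    (hK : ∀ e, cylProb μ t (n + 1) e ≤ K * windowWeight f (windowCount (n + 1) e 0))
    (x : ℕ → Bool) (hx : cylProb μ t (n + 1) x ≤ κ * windowWeight f (windowCount (n + 1) x 0))
    (e : ℕ → Bool) : cylProb μ (t + (n + 1)) (n + 1) e ≤
      (K - δ ^ (n + 1) * (K - κ)) * windowWeight f (windowCount (n + 1) e 0) := by
  have h0' : ∀ c, 0 < f c := fun c => hδ.trans_le (h0 c)
  have h1' : ∀ c, f c < 1 := fun c => by linarith [h1 c]
  have sum_one : ∀ q, bitProb q true + bitProb q false = 1 := fun q => by simp [bitProb]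
  have mono : ∀ k e, cylProb μ (t + k) (n + 1) e ≤
      K * windowWeight f (windowCount (n + 1) e 0) := by
    intro k
    induction k with
    | zero => exact hK
    | succ k ih =>
      intro e
      refine (h.cylProb_window_succ_le h0' h1' (t + k) e (fun _ => K) fun b => ih _).trans ?_
      rw [Fintype.sum_bool, ← mul_add, sum_one, mul_one]
  have main : ∀ k ≤ n + 1, ∀ e : ℕ → Bool, (∀ j < n + 1 - k, e j = x (j + k)) →
      cylProb μ (t + k) (n + 1) e ≤
        (K - δ ^ k * (K - κ)) * windowWeight f (windowCount (n + 1) e 0) := by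
    intro k
    induction k with
    | zero =>
      intro _ e he
      have he' : ∀ j < n + 1, e j = x j := he
      rw [add_zero, cylProb_congr μ t (n + 1) he',
        windowCount_congr (n + 1) 0 fun j _ hj => he' j (by omega)]
      simpa using hx
    | succ k ih =>
      intro hk e he
      refine (h.cylProb_window_succ_le h0' h1' (t + k) e
        (fun b => if b = x k then K - δ ^ k * (K - κ) else K) fun b => ?_).trans ?_
      · by_cases hb : b = x k
        · rw [if_pos hb]
          refine ih (by omega) _ fun j hj => ?_
          cases j with
          | zero => simpa [consSeq] using hb
          | succ j =>
            rw [show j + 1 + k = j + (k + 1) by ring]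
            exact he j (by omega)
        · rw [if_neg hb]
          exact mono k _
      · refine mul_le_mul_of_nonneg_right ?_ (windowWeight_pos h0' h1' _).le
        set q := f (windowCount (n + 1) e 0)
        have hq := sum_one q
        have hb := le_bitProb (h0 (windowCount (n + 1) e 0)) (h1 (windowCount (n + 1) e 0)) (x k)
        have hp : 0 ≤ δ ^ k * (K - κ) := mul_nonneg (pow_nonneg hδ.le _) (sub_nonneg.2 hκ)
        have := mul_le_mul_of_nonneg_left hb hp
        rw [Fintype.sum_bool, pow_succ]
        have hKq : K * bitProb q true + K * bitProb q false = K := by rw [← mul_add, hq, mul_one]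
        cases hxk : x k <;> rw [hxk] at this <;> simp <;> linarith
  exact main (n + 1) le_rfl e fun j hj => by omega

lemma exists_cylProb_le_two {n : ℕ} (h : IsWindowChain (n + 1) f μ) {δ : ℝ} (hδ : 0 < δ)
    (h0 : ∀ c, δ ≤ f c) (h1 : ∀ c, f c ≤ 1 - δ) (t₀ : ℕ) :
    ∃ t ≥ t₀, ∀ e, cylProb μ t (n + 1) e ≤
      2 / (∑ A ∈ (Finset.range (n + 1)).powerset, windowWeight f A.card) *
        windowWeight f (windowCount (n + 1) e 0) := by
  have h0' : ∀ c, 0 < f c := fun c => hδ.trans_le (h0 c)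
  have h1' : ∀ c, f c < 1 := fun c => by linarith [h1 c]
  have hw := windowWeight_pos h0' h1'
  set Z := ∑ A ∈ (Finset.range (n + 1)).powerset, windowWeight f A.card with hZ
  have hZpos : 0 < Z := Finset.sum_pos (fun A _ => hw _) ⟨∅, by simp⟩
  have hx : ∀ t, ∃ x, cylProb μ t (n + 1) x ≤
      1 / Z * windowWeight f (windowCount (n + 1) x 0) := by
    intro t
    by_contra! hcon
    have := Finset.sum_lt_sum_of_nonempty
      (s := (Finset.range (n + 1)).powerset) ⟨∅, by simp⟩
      (fun A _ => hcon (blockSeq A (n + 1) fun _ => true))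
    rw [sum_cylProb, ← Finset.mul_sum, Finset.sum_congr rfl fun A hA => by
      rw [windowCount_blockSeq (Finset.mem_powerset.1 hA)], ← hZ,
      one_div_mul_cancel hZpos.ne'] at this
    exact lt_irrefl _ this
  obtain ⟨C, hC0, hC⟩ : ∃ C : ℝ, 0 ≤ C ∧ ∀ c ≤ n + 1, 1 ≤ C * windowWeight f c := by
    refine ⟨∑ c ∈ Finset.range (n + 2), (windowWeight f c)⁻¹,
      Finset.sum_nonneg fun c _ => (inv_pos.2 (hw c)).le, fun c hc => ?_⟩
    rw [← div_le_iff₀ (hw c), one_div]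
    exact Finset.single_le_sum (f := fun c => (windowWeight f c)⁻¹)
      (fun c _ => (inv_pos.2 (hw c)).le) (Finset.mem_range.2 (by omega))
  have hδ1 : δ < 1 := by linarith [h0 0, h1' 0]
  have hpow : δ ^ (n + 1) ≤ 1 := pow_le_one₀ hδ.le hδ1.le
  have iter : ∀ j e, cylProb μ (j * (n + 1)) (n + 1) e ≤
      (1 / Z + (1 - δ ^ (n + 1)) ^ j * C) * windowWeight f (windowCount (n + 1) e 0) := by
    intro j
    induction j with
    | zero =>
      intro e
      refine (cylProb_le_one _ _ _ _).trans ((hC _ (windowCount_le (n + 1) 0 e)).trans ?_)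
      refine mul_le_mul_of_nonneg_right ?_ (hw _).le
      have := one_div_pos.2 hZpos
      simp only [pow_zero, one_mul]
      linarith
    | succ j ih =>
      intro e
      obtain ⟨x, hx⟩ := hx (j * (n + 1))
      have hnn : 0 ≤ (1 - δ ^ (n + 1)) ^ j * C :=
        mul_nonneg (pow_nonneg (sub_nonneg.2 hpow) _) hC0
      rw [Nat.succ_mul]
      refine (h.cylProb_contract hδ h0 h1 _ (by linarith) ih x hx e).trans (le_of_eq ?_)
      ring
  have hlim : Tendsto (fun j : ℕ => (1 - δ ^ (n + 1)) ^ j * C) atTop (𝓝 0) := by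
    have := (tendsto_pow_atTop_nhds_zero_of_lt_one (sub_nonneg.2 hpow)
      (by linarith [pow_pos hδ (n + 1)])).mul_const C
    simpa using this
  obtain ⟨j, hj, hjt⟩ := ((hlim.eventually_lt_const (one_div_pos.2 hZpos)).and
    (eventually_ge_atTop t₀)).exists
  refine ⟨j * (n + 1), le_trans hjt (Nat.le_mul_of_pos_right _ (by omega)), fun e =>
    (iter j e).trans (mul_le_mul_of_nonneg_right ?_ (hw _).le)⟩
  rw [show (2 : ℝ) / Z = 1 / Z + 1 / Z by ring]
  linarith

end IsWindowChain

/-- The binomial probability of `c` successes in `N` trials with success probability `q`. -/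
noncomputable def binomMass (N : ℕ) (q : ℝ) (c : ℕ) : ℝ :=
  N.choose c * q ^ c * (1 - q) ^ (N - c)

lemma binomMass_nonneg {q : ℝ} (h0 : 0 ≤ q) (h1 : q ≤ 1) (N c : ℕ) : 0 ≤ binomMass N q c := by
  have := sub_nonneg.2 h1
  unfold binomMass
  positivity

lemma sum_binomMass (N : ℕ) (q : ℝ) : ∑ c ∈ Finset.range (N + 1), binomMass N q c = 1 := by
  have := add_pow q (1 - q) N
  rw [add_sub_cancel, one_pow] at this
  rw [this]
  refine Finset.sum_congr rfl fun c _ => ?_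
  unfold binomMass
  ring

/-- Chebyshev's inequality for the binomial distribution. -/
lemma sum_binomMass_far_le {N : ℕ} (hN : N ≠ 0) {q ε : ℝ} (h0 : 0 ≤ q) (h1 : q ≤ 1)
    (hε : 0 < ε) :
    ∑ c ∈ (Finset.range (N + 1)).filter (fun c : ℕ => ε ≤ |(c : ℝ) / N - q|), binomMass N q c ≤
      1 / (N * ε ^ 2) := by
  have hvar : ∑ c ∈ Finset.range (N + 1), (q - (c : ℝ) / N) ^ 2 * binomMass N q c =
      q * (1 - q) / N := by
    rw [← bernstein.variance hN (⟨q, h0, h1⟩ : unitInterval), Finset.sum_range]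
    refine Finset.sum_congr rfl fun c _ => ?_
    simp [bernstein_apply, binomMass, bernstein.z]
  have hNpos : (0 : ℝ) < N := by positivity
  have hle : ε ^ 2 * ∑ c ∈ (Finset.range (N + 1)).filter (fun c : ℕ => ε ≤ |(c : ℝ) / N - q|),
      binomMass N q c ≤ q * (1 - q) / N := by
    rw [← hvar, Finset.mul_sum]
    refine (Finset.sum_le_sum fun c hc => ?_).trans (Finset.sum_le_sum_of_subset_of_nonneg
      (Finset.filter_subset _ _) fun c _ _ =>
        mul_nonneg (sq_nonneg _) (binomMass_nonneg h0 h1 _ _))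
    refine mul_le_mul_of_nonneg_right ?_ (binomMass_nonneg h0 h1 _ _)
    rw [← sq_abs (q - _), abs_sub_comm]
    exact pow_le_pow_left₀ hε.le (Finset.mem_filter.1 hc).2 2
  have hq : q * (1 - q) / N ≤ 1 / N := by
    gcongr
    nlinarith
  rw [le_div_iff₀ (by positivity), ← mul_assoc, mul_comm, ← mul_assoc]
  have := hle.trans hq
  rw [le_div_iff₀ hNpos] at this
  linarith

section Stage

variable {l : ℕ} {M : ℕ → ℕ}

lemma stage_le (c : ℕ) : stage l M c ≤ l := by
  refine Finset.sup_le fun i hi => ?_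
  simp only [Finset.mem_filter, Finset.mem_range] at hi
  exact Nat.lt_succ_iff.1 hi.1

lemma le_stage {i c : ℕ} (hi : i ≤ l) (hc : M i ≤ c) : i ≤ stage l M c :=
  Finset.le_sup (f := id)
    (Finset.mem_filter.2 ⟨Finset.mem_range.2 (Nat.lt_succ_of_le hi), hc⟩)

lemma threshold_stage_le (hM0 : M 0 = 0) (c : ℕ) : M (stage l M c) ≤ c := by
  have hne : ((Finset.range (l + 1)).filter (fun i => M i ≤ c)).Nonempty :=
    ⟨0, by simp [hM0]⟩
  obtain ⟨i, hi, h⟩ := Finset.exists_mem_eq_sup _ hne id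
  have : stage l M c = i := h
  rw [this]
  exact (Finset.mem_filter.1 hi).2

lemma stage_mono (hM0 : M 0 = 0) {c d : ℕ} (h : c ≤ d) : stage l M c ≤ stage l M d :=
  le_stage (stage_le c) ((threshold_stage_le hM0 c).trans h)

lemma stage_eq {i c : ℕ} (hM0 : M 0 = 0) (hmono : ∀ i < l, M i ≤ M (i + 1)) (hi : i ≤ l)
    (hlo : M i ≤ c) (hhi : i < l → c < M (i + 1)) : stage l M c = i := by
  refine le_antisymm ?_ (le_stage hi hlo)
  by_contra! hlt
  have hil : i < l := hlt.trans_le (stage_le c)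
  have hmon : ∀ j, i + 1 ≤ j → j ≤ l → M (i + 1) ≤ M j := by
    intro j hj
    induction j, hj using Nat.le_induction with
    | base => exact fun _ => le_rfl
    | succ j _ ih => exact fun hjl => (ih (by omega)).trans (hmono j (by omega))
  exact absurd (threshold_stage_le hM0 c)
    (not_le.2 ((hhi hil).trans_le (hmon _ hlt (stage_le c))))

lemma oddsProd_eq_mul_pow {f : ℕ → ℝ} {a b : ℕ} {q : ℝ} (hab : a ≤ b)
    (h : ∀ s, a ≤ s → s < b → f s = q) :
    oddsProd f b = oddsProd f a * (q / (1 - q)) ^ (b - a) := by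
  unfold oddsProd
  rw [← Finset.prod_range_mul_prod_Ico _ hab]
  congr 1
  rw [Finset.prod_congr rfl fun s hs => by
    rw [h s (Finset.mem_Ico.1 hs).1 (Finset.mem_Ico.1 hs).2], Finset.prod_const, Nat.card_Ico]

/-- The unnormalized stationary mass of the `i`-th stage when its threshold window is extended
to all of `{0, …, N}`. -/
noncomputable def stageMass (N l : ℕ) (M : ℕ → ℕ) (p : ℕ → ℝ) (i : ℕ) : ℝ :=
  oddsProd (fun c => p (stage l M c)) (M i) / (p i ^ M i * (1 - p i) ^ (N - M i))

variable {N : ℕ} {p : ℕ → ℝ}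

lemma stageMass_pos (hp0 : ∀ i ≤ l, 0 < p i) (hp1 : ∀ i ≤ l, p i < 1) {i : ℕ} (hi : i ≤ l) :
    0 < stageMass N l M p i :=
  div_pos (oddsProd_pos (fun c => hp0 _ (stage_le c)) (fun c => hp1 _ (stage_le c)) _)
    (mul_pos (pow_pos (hp0 i hi) _) (pow_pos (sub_pos.2 (hp1 i hi)) _))

lemma choose_mul_oddsProd (hM0 : M 0 = 0) (hp0 : ∀ i ≤ l, 0 < p i) (hp1 : ∀ i ≤ l, p i < 1)
    {c : ℕ} (hc : c ≤ N) :
    (N.choose c : ℝ) * oddsProd (fun c => p (stage l M c)) c =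
      stageMass N l M p (stage l M c) * binomMass N (p (stage l M c)) c := by
  obtain ⟨i, hi⟩ : ∃ i, stage l M c = i := ⟨_, rfl⟩
  have hil : i ≤ l := hi ▸ stage_le c
  have hMc : M i ≤ c := hi ▸ threshold_stage_le hM0 c
  rw [hi]
  rw [oddsProd_eq_mul_pow (q := p i) hMc]
  · unfold stageMass binomMass
    obtain ⟨d, rfl⟩ := Nat.exists_eq_add_of_le hMc
    obtain ⟨k, rfl⟩ := Nat.exists_eq_add_of_le hc
    rw [show M i + d - M i = d by omega, show M i + d + k - (M i + d) = k by omega,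
      show M i + d + k - M i = d + k by omega, div_pow, pow_add, pow_add]
    have := (hp0 i hil).ne'
    have := (sub_pos.2 (hp1 i hil)).ne'
    field_simp
  · intro s hs hsc
    have : stage l M s = i := le_antisymm (hi ▸ stage_mono hM0 hsc.le) (le_stage hil hs)
    simp only [this]

/-- Upper bound for the stationary mass of the windows whose density is far from `p i₀`,
given that all densities close to `p i₀` belong to stage `i₀`. -/
lemma far_mass_le (hN : N ≠ 0) (hM0 : M 0 = 0) {δ ε : ℝ} (hδ : 0 < δ) (hε : 0 < ε)
    (hp0 : ∀ i ≤ l, δ ≤ p i) (hp1 : ∀ i ≤ l, p i ≤ 1 - δ) {i₀ : ℕ} (hi₀ : i₀ ≤ l)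
    (hnear : ∀ c ≤ N, |(c : ℝ) / N - p i₀| < ε → stage l M c = i₀)
    (hβ : 1 / ((N : ℝ) * ε ^ 2) < 1) :
    (∑ A ∈ (Finset.range N).powerset.filter (fun A => ε ≤ |(A.card : ℝ) / N - p i₀|),
      windowWeight (fun c => p (stage l M c)) A.card) /
    (∑ A ∈ (Finset.range N).powerset, windowWeight (fun c => p (stage l M c)) A.card) ≤
    1 / δ * (∑ i ∈ (Finset.range (l + 1)).erase i₀,
        stageMass N l M p i / stageMass N l M p i₀ + 1 / (N * ε ^ 2)) /
      (1 - 1 / (N * ε ^ 2)) := by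
  set f : ℕ → ℝ := fun c => p (stage l M c) with hf
  set β := 1 / ((N : ℝ) * ε ^ 2) with hβdef
  set J := stageMass N l M p with hJ
  have hq0 : ∀ i ≤ l, 0 < p i := fun i hi => hδ.trans_le (hp0 i hi)
  have hq1 : ∀ i ≤ l, p i < 1 := fun i hi => by linarith [hp1 i hi]
  have hf0 : ∀ c, 0 < f c := fun c => hq0 _ (stage_le c)
  have hf1 : ∀ c, f c < 1 := fun c => hq1 _ (stage_le c)
  have hJpos : ∀ i ≤ l, 0 < J i := fun i hi => stageMass_pos hq0 hq1 hi
  have hbin : ∀ i ≤ l, ∀ c, 0 ≤ binomMass N (p i) c := fun i hi c =>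
    binomMass_nonneg (hq0 i hi).le (hq1 i hi).le N c
  have hcheb : ∑ c ∈ (Finset.range (N + 1)).filter (fun c : ℕ => ε ≤ |(c : ℝ) / N - p i₀|),
      binomMass N (p i₀) c ≤ β :=
    sum_binomMass_far_le hN (hq0 _ hi₀).le (hq1 _ hi₀).le hε
  have hlower : ∀ c, oddsProd f c ≤ windowWeight f c := fun c => by
    rw [windowWeight, le_div_iff₀ (sub_pos.2 (hf1 c))]
    nlinarith [oddsProd_pos hf0 hf1 c, hf0 c]
  have hupper : ∀ c, windowWeight f c ≤ 1 / δ * oddsProd f c := fun c => by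
    rw [windowWeight, div_eq_mul_one_div, mul_comm]
    have : δ ≤ 1 - f c := by linarith [hp1 _ (stage_le (M := M) c)]
    exact mul_le_mul_of_nonneg_right (one_div_le_one_div_of_le hδ this)
      (oddsProd_pos hf0 hf1 c).le
  have hfar : ∑ A ∈ (Finset.range N).powerset.filter (fun A => ε ≤ |(A.card : ℝ) / N - p i₀|),
      windowWeight f A.card ≤
      1 / δ * (∑ i ∈ (Finset.range (l + 1)).erase i₀, J i + J i₀ * β) := by
    rw [Finset.sum_filter, Finset.sum_powerset_apply_card
      (fun c : ℕ => if ε ≤ |(c : ℝ) / N - p i₀| then windowWeight f c else 0), Finset.card_range]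
    have hterm : ∀ c ∈ Finset.range (N + 1),
        N.choose c • (if ε ≤ |(c : ℝ) / N - p i₀| then windowWeight f c else 0) ≤
        1 / δ * (∑ i ∈ (Finset.range (l + 1)).erase i₀, J i * binomMass N (p i) c +
          J i₀ * if ε ≤ |(c : ℝ) / N - p i₀| then binomMass N (p i₀) c else 0) := by
      intro c hc
      have hcN : c ≤ N := Nat.lt_succ_iff.1 (Finset.mem_range.1 hc)
      have hnn : ∀ i ∈ (Finset.range (l + 1)).erase i₀, 0 ≤ J i * binomMass N (p i) c := by
        intro i hi
        have : i ≤ l := Nat.lt_succ_iff.1 (Finset.mem_range.1 (Finset.mem_of_mem_erase hi))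
        exact mul_nonneg (hJpos i this).le (hbin i this c)
      have hsum := Finset.sum_nonneg hnn
      by_cases hfarc : ε ≤ |(c : ℝ) / N - p i₀|
      · rw [if_pos hfarc, if_pos hfarc, nsmul_eq_mul]
        have h1 : (N.choose c : ℝ) * windowWeight f c ≤
            1 / δ * ((N.choose c : ℝ) * oddsProd f c) := by
          calc _ ≤ (N.choose c : ℝ) * (1 / δ * oddsProd f c) :=
                mul_le_mul_of_nonneg_left (hupper c) (Nat.cast_nonneg _)
            _ = _ := by ring
        refine h1.trans (mul_le_mul_of_nonneg_left ?_ (one_div_pos.2 hδ).le)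
        rw [choose_mul_oddsProd hM0 hq0 hq1 hcN]
        by_cases hst : stage l M c = i₀
        · rw [hst]
          linarith
        · have h2 := Finset.single_le_sum hnn (Finset.mem_erase.2
            ⟨hst, Finset.mem_range.2 (Nat.lt_succ_of_le (stage_le c))⟩)
          have h3 := mul_nonneg (hJpos i₀ hi₀).le (hbin i₀ hi₀ c)
          linarith
      · rw [if_neg hfarc, if_neg hfarc, smul_zero, mul_zero, add_zero]
        exact mul_nonneg (one_div_pos.2 hδ).le hsum
    refine (Finset.sum_le_sum hterm).trans ?_
    rw [← Finset.mul_sum, Finset.sum_add_distrib, ← Finset.mul_sum, ← Finset.sum_filter,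
      Finset.sum_comm]
    simp only [← Finset.mul_sum, sum_binomMass, mul_one]
    have := mul_le_mul_of_nonneg_left hcheb (hJpos i₀ hi₀).le
    have hδ' := (one_div_pos.2 hδ).le
    gcongr
  have htotal : J i₀ * (1 - β) ≤
      ∑ A ∈ (Finset.range N).powerset, windowWeight f A.card := by
    rw [Finset.sum_powerset_apply_card (fun c => windowWeight f c), Finset.card_range]
    have hsplit := Finset.sum_filter_add_sum_filter_not (Finset.range (N + 1))
      (fun c : ℕ => ε ≤ |(c : ℝ) / N - p i₀|) (fun c => binomMass N (p i₀) c)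
    rw [sum_binomMass] at hsplit
    calc J i₀ * (1 - β) ≤ J i₀ * ∑ c ∈ (Finset.range (N + 1)).filter
          (fun c : ℕ => ¬ ε ≤ |(c : ℝ) / N - p i₀|), binomMass N (p i₀) c :=
          mul_le_mul_of_nonneg_left (by linarith) (hJpos i₀ hi₀).le
      _ ≤ ∑ c ∈ (Finset.range (N + 1)).filter
          (fun c : ℕ => ¬ ε ≤ |(c : ℝ) / N - p i₀|), N.choose c • windowWeight f c := by
          rw [Finset.mul_sum]
          refine Finset.sum_le_sum fun c hc => ?_
          obtain ⟨hc, hnc⟩ := Finset.mem_filter.1 hc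
          have hcN : c ≤ N := Nat.lt_succ_iff.1 (Finset.mem_range.1 hc)
          have h1 := choose_mul_oddsProd (l := l) hM0 hq0 hq1 hcN
          rw [hnear c hcN (not_le.1 hnc)] at h1
          rw [← h1, nsmul_eq_mul]
          exact mul_le_mul_of_nonneg_left (hlower c) (Nat.cast_nonneg _)
      _ ≤ _ := Finset.sum_le_sum_of_subset_of_nonneg (Finset.filter_subset _ _) fun c _ _ =>
          nsmul_nonneg (windowWeight_pos hf0 hf1 c).le _
  have hJ₀ := hJpos i₀ hi₀
  have hβ' : 0 < 1 - β := sub_pos.2 hβ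
  have hnum : 0 ≤ 1 / δ * (∑ i ∈ (Finset.range (l + 1)).erase i₀, J i + J i₀ * β) :=
    (Finset.sum_nonneg fun A _ => (windowWeight_pos hf0 hf1 _).le).trans hfar
  refine (div_le_div₀ hnum hfar (mul_pos hJ₀ hβ') htotal).trans (le_of_eq ?_)
  rw [← Finset.sum_div]
  field_simp

end Stage

/-- Strict monotonicity of the cross entropy on the right of its minimum. -/
lemma crossEntropy_lt {x q q' : ℝ} (hq : 0 < q) (hx0 : 0 ≤ x) (hxq : x ≤ q) (hqq : q < q')
    (hq' : q' < 1) : x * Real.log q' + (1 - x) * Real.log (1 - q') <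
      x * Real.log q + (1 - x) * Real.log (1 - q) := by
  have h1q : 0 < 1 - q := by linarith
  have h1q' : 0 < 1 - q' := by linarith
  have ha : Real.log q' - Real.log q ≤ (q' - q) / q := by
    rw [← Real.log_div (by linarith) hq.ne']
    refine (Real.log_le_sub_one_of_pos (div_pos (by linarith) hq)).trans (le_of_eq ?_)
    field_simp
  have hb : Real.log (1 - q') - Real.log (1 - q) < -((q' - q) / (1 - q)) := by
    rw [← Real.log_div h1q'.ne' h1q.ne']
    refine (Real.log_lt_sub_one_of_pos (div_pos h1q' h1q) ?_).trans_eq ?_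
    · rw [Ne, div_eq_one_iff_eq h1q.ne']
      linarith
    · field_simp
      ring
  have ha' : x * ((q' - q) / q) ≤ q' - q := by
    rw [mul_div_assoc', div_le_iff₀ hq]
    nlinarith
  have hb' : q' - q ≤ (1 - x) * ((q' - q) / (1 - q)) := by
    rw [mul_div_assoc', le_div_iff₀ h1q]
    nlinarith
  have h1 := mul_le_mul_of_nonneg_left ha hx0
  have h2 := mul_lt_mul_of_pos_left hb (show 0 < 1 - x by linarith)
  linarith

lemma log_Jfun {l : ℕ} {p r : ℕ → ℝ} (hp0 : ∀ i ≤ l, 0 < p i) (hp1 : ∀ i ≤ l, p i < 1)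
    {i : ℕ} (hi : i ≤ l) : Real.log (Jfun p r i) =
      -(r i * Real.log (p i) + (1 - r i) * Real.log (1 - p i)) +
        ∑ k ∈ Finset.Icc 1 i, (r k - r (k - 1)) * Real.log (p (k - 1) / (1 - p (k - 1))) := by
  have hodds : ∀ k ∈ Finset.Icc 1 i, 0 < p (k - 1) / (1 - p (k - 1)) := fun k hk => by
    have := (Finset.mem_Icc.1 hk).2
    exact div_pos (hp0 _ (by omega)) (sub_pos.2 (hp1 _ (by omega)))
  have h0 := hp0 i hi
  have h1 := sub_pos.2 (hp1 i hi)
  have hprod : 0 < ∏ k ∈ Finset.Icc 1 i, (p (k - 1) / (1 - p (k - 1))) ^ (r k - r (k - 1)) :=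
    Finset.prod_pos fun k hk => Real.rpow_pos_of_pos (hodds k hk) _
  rw [Jfun, Real.log_mul (by positivity) hprod.ne', one_div, Real.log_inv,
    Real.log_mul (by positivity) (by positivity), Real.log_rpow h0, Real.log_rpow h1,
    Real.log_prod fun k hk => (Real.rpow_pos_of_pos (hodds k hk) _).ne']
  congr 1
  exact Finset.sum_congr rfl fun k hk => Real.log_rpow (hodds k hk) _

lemma Jfun_pos {l : ℕ} {p r : ℕ → ℝ} (hp0 : ∀ i ≤ l, 0 < p i) (hp1 : ∀ i ≤ l, p i < 1)
    {i : ℕ} (hi : i ≤ l) : 0 < Jfun p r i := by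
  have h0 := hp0 i hi
  have h1 := sub_pos.2 (hp1 i hi)
  refine mul_pos (by positivity) (Finset.prod_pos fun k hk => Real.rpow_pos_of_pos ?_ _)
  have := (Finset.mem_Icc.1 hk).2
  exact div_pos (hp0 _ (by omega)) (sub_pos.2 (hp1 _ (by omega)))

lemma log_Jfun_succ {l : ℕ} {p r : ℕ → ℝ} (hp0 : ∀ i ≤ l, 0 < p i) (hp1 : ∀ i ≤ l, p i < 1)
    {i : ℕ} (hi : i < l) : Real.log (Jfun p r (i + 1)) - Real.log (Jfun p r i) =
      (r (i + 1) * Real.log (p i) + (1 - r (i + 1)) * Real.log (1 - p i)) -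
      (r (i + 1) * Real.log (p (i + 1)) + (1 - r (i + 1)) * Real.log (1 - p (i + 1))) := by
  rw [log_Jfun hp0 hp1 hi, log_Jfun hp0 hp1 hi.le, Finset.sum_Icc_succ_top (by omega),
    Nat.add_sub_cancel, Real.log_div (hp0 i hi.le).ne' (sub_pos.2 (hp1 i hi.le)).ne']
  ring

lemma Jfun_lt_succ {l : ℕ} {p r : ℕ → ℝ} (hp0 : ∀ i ≤ l, 0 < p i) (hp1 : ∀ i ≤ l, p i < 1)
    {i : ℕ} (hi : i < l) (hp : p i < p (i + 1)) (hr : 0 ≤ r (i + 1)) (h : r (i + 1) ≤ p i) :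
    Jfun p r i < Jfun p r (i + 1) := by
  rw [← Real.log_lt_log_iff (Jfun_pos hp0 hp1 hi.le) (Jfun_pos hp0 hp1 hi), ← sub_pos,
    log_Jfun_succ hp0 hp1 hi, sub_pos]
  exact crossEntropy_lt (hp0 i hi.le) hr h hp (hp1 _ hi)

lemma Jfun_succ_lt {l : ℕ} {p r : ℕ → ℝ} (hp0 : ∀ i ≤ l, 0 < p i) (hp1 : ∀ i ≤ l, p i < 1)
    {i : ℕ} (hi : i < l) (hp : p i < p (i + 1)) (hr : r (i + 1) ≤ 1) (h : p (i + 1) ≤ r (i + 1)) :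
    Jfun p r (i + 1) < Jfun p r i := by
  rw [← Real.log_lt_log_iff (Jfun_pos hp0 hp1 hi) (Jfun_pos hp0 hp1 hi.le), ← sub_neg,
    log_Jfun_succ hp0 hp1 hi, sub_neg]
  have := crossEntropy_lt (x := 1 - r (i + 1)) (q := 1 - p (i + 1)) (q' := 1 - p i)
    (sub_pos.2 (hp1 _ hi)) (by linarith) (by linarith) (by linarith)
    (by linarith [hp0 i hi.le])
  simp only [sub_sub_cancel] at this
  linarith

/-- The unique maximizer of `Jfun` among the admissible stages is its unique maximizer among
all stages. -/
lemma Jfun_lt_of_admissible_argmax {l : ℕ} {p r : ℕ → ℝ} (hp0 : ∀ i ≤ l, 0 < p i)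
    (hp1 : ∀ i ≤ l, p i < 1) (hpmono : ∀ i < l, p i < p (i + 1)) (hr0 : r 0 = 0)
    (hrtop : r (l + 1) = 1) (hrmem : ∀ i, 1 ≤ i → i ≤ l → r i ∈ Set.Icc (0 : ℝ) 1)
    {i₀ : ℕ} (hi₀ : i₀ ≤ l) (hargmax : ∀ i ≤ l, r i < p i → p i < r (i + 1) → i ≠ i₀ →
      Jfun p r i < Jfun p r i₀) {i : ℕ} (hi : i ≤ l) (hne : i ≠ i₀) :
    Jfun p r i < Jfun p r i₀ := by
  have hinadm : ∀ i ≤ l, ¬ (r i < p i ∧ p i < r (i + 1)) →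
      ∃ j ≤ l, Jfun p r i < Jfun p r j := by
    intro i hi hn
    by_cases hlo : r i < p i
    · have hhi : r (i + 1) ≤ p i := not_lt.1 fun h => hn ⟨hlo, h⟩
      have hil : i < l := lt_of_le_of_ne hi fun h => by
        subst h
        linarith [hp1 i hi]
      exact ⟨i + 1, hil, Jfun_lt_succ hp0 hp1 hil (hpmono i hil)
        (hrmem (i + 1) (by omega) hil).1 hhi⟩
    · cases i with
      | zero => exact absurd (hr0 ▸ hp0 0 hi) hlo
      | succ i => exact ⟨i, by omega, Jfun_succ_lt hp0 hp1 hi (hpmono i hi)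
          (hrmem (i + 1) (by omega) hi).2 (not_lt.1 hlo)⟩
  obtain ⟨j, hj, hjmax⟩ := Finset.exists_max_image (Finset.range (l + 1)) (Jfun p r) ⟨0, by simp⟩
  have hjl : j ≤ l := Nat.lt_succ_iff.1 (Finset.mem_range.1 hj)
  have hjmax' : ∀ k ≤ l, Jfun p r k ≤ Jfun p r j := fun k hk =>
    hjmax k (Finset.mem_range.2 (Nat.lt_succ_of_le hk))
  have hjadm : r j < p j ∧ p j < r (j + 1) := by
    by_contra hn
    obtain ⟨k, hk, hlt⟩ := hinadm j hjl hn
    exact absurd (hjmax' k hk) (not_le.2 hlt)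
  have hji : j = i₀ := by
    by_contra hne
    exact absurd (hjmax' i₀ hi₀) (not_le.2 (hargmax j hjl hjadm.1 hjadm.2 hne))
  subst hji
  by_cases hadm : r i < p i ∧ p i < r (i + 1)
  · exact hargmax i hi hadm.1 hadm.2 hne
  · obtain ⟨k, hk, hlt⟩ := hinadm i hi hadm
    exact hlt.trans_le (hjmax' k hk)

section Asymptotics

variable {l : ℕ} {p r : ℕ → ℝ} {M : ℕ → ℕ → ℕ}

lemma tendsto_log_oddsProd_div (hp0 : ∀ i ≤ l, 0 < p i) (hp1 : ∀ i ≤ l, p i < 1)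
    (hM0 : ∀ N, M N 0 = 0) (hmono : ∀ N, l ≤ N → ∀ i < l, M N i ≤ M N (i + 1))
    (hMconv : ∀ i ≤ l, Tendsto (fun N => (M N i : ℝ) / N) atTop (𝓝 (r i)))
    {i : ℕ} (hi : i ≤ l) :
    Tendsto (fun N : ℕ => Real.log (oddsProd (fun c => p (stage l (M N) c)) (M N i)) / N) atTop
      (𝓝 (∑ k ∈ Finset.Icc 1 i, (r k - r (k - 1)) * Real.log (p (k - 1) / (1 - p (k - 1))))) := by
  induction i with
  | zero => simp [hM0, oddsProd]
  | succ i ih =>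
    rw [Finset.sum_Icc_succ_top (by omega), Nat.add_sub_cancel]
    refine ((ih (by omega)).add (((hMconv (i + 1) hi).sub (hMconv i (by omega))).mul_const
      (Real.log (p i / (1 - p i))))).congr' ?_
    filter_upwards [eventually_ge_atTop l] with N hN
    have hle := hmono N hN i hi
    have hodds : 0 < p i / (1 - p i) := div_pos (hp0 i (by omega)) (sub_pos.2 (hp1 i (by omega)))
    rw [oddsProd_eq_mul_pow (q := p i) hle fun s hs hs' => by
      rw [stage_eq (hM0 N) (hmono N hN) (by omega) hs fun _ => hs'],
      Real.log_mul (oddsProd_pos (fun c => hp0 _ (stage_le c)) (fun c => hp1 _ (stage_le c)) _).ne'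
        (pow_pos hodds _).ne', Real.log_pow, Nat.cast_sub hle]
    ring

lemma tendsto_log_stageMass_div (hp0 : ∀ i ≤ l, 0 < p i) (hp1 : ∀ i ≤ l, p i < 1)
    (hM0 : ∀ N, M N 0 = 0) (hmono : ∀ N, l ≤ N → ∀ i < l, M N i ≤ M N (i + 1))
    (hMN : ∀ N, l ≤ N → ∀ i ≤ l, M N i ≤ N)
    (hMconv : ∀ i ≤ l, Tendsto (fun N => (M N i : ℝ) / N) atTop (𝓝 (r i)))
    {i : ℕ} (hi : i ≤ l) :
    Tendsto (fun N : ℕ => Real.log (stageMass N l (M N) p i) / N) atTop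
      (𝓝 (Real.log (Jfun p r i))) := by
  rw [log_Jfun hp0 hp1 hi, neg_add_eq_sub]
  refine ((tendsto_log_oddsProd_div hp0 hp1 hM0 hmono hMconv hi).sub
    (((hMconv i hi).mul_const (Real.log (p i))).add
      (((hMconv i hi).const_sub 1).mul_const (Real.log (1 - p i))))).congr' ?_
  filter_upwards [eventually_ge_atTop l, eventually_gt_atTop 0] with N hN hN0
  have hNR : (N : ℝ) ≠ 0 := by positivity
  have h0 := hp0 i hi
  have h1 := sub_pos.2 (hp1 i hi)
  rw [stageMass, Real.log_div (oddsProd_pos (fun c => hp0 _ (stage_le c))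
      (fun c => hp1 _ (stage_le c)) _).ne' (by positivity),
    Real.log_mul (by positivity) (by positivity), Real.log_pow, Real.log_pow,
    Nat.cast_sub (hMN N hN i hi)]
  field_simp

lemma tendsto_stageMass_ratio (hp0 : ∀ i ≤ l, 0 < p i) (hp1 : ∀ i ≤ l, p i < 1)
    (hM0 : ∀ N, M N 0 = 0) (hmono : ∀ N, l ≤ N → ∀ i < l, M N i ≤ M N (i + 1))
    (hMN : ∀ N, l ≤ N → ∀ i ≤ l, M N i ≤ N)
    (hMconv : ∀ i ≤ l, Tendsto (fun N => (M N i : ℝ) / N) atTop (𝓝 (r i)))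
    {i j : ℕ} (hi : i ≤ l) (hj : j ≤ l) (hlt : Jfun p r i < Jfun p r j) :
    Tendsto (fun N : ℕ => stageMass N l (M N) p i / stageMass N l (M N) p j) atTop (𝓝 0) := by
  have hneg : Real.log (Jfun p r i) - Real.log (Jfun p r j) < 0 :=
    sub_neg.2 (Real.log_lt_log (Jfun_pos hp0 hp1 hi) hlt)
  have hlim := (tendsto_natCast_atTop_atTop (R := ℝ)).atTop_mul_neg hneg
    ((tendsto_log_stageMass_div hp0 hp1 hM0 hmono hMN hMconv hi).sub
      (tendsto_log_stageMass_div hp0 hp1 hM0 hmono hMN hMconv hj))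
  refine (Real.tendsto_exp_atBot.comp hlim).congr' ?_
  filter_upwards [eventually_gt_atTop 0] with N hN0
  have hNR : (N : ℝ) ≠ 0 := by positivity
  rw [Function.comp_apply, ← sub_div, mul_div_cancel₀ _ hNR, Real.exp_sub,
    Real.exp_log (stageMass_pos hp0 hp1 hi), Real.exp_log (stageMass_pos hp0 hp1 hj)]

/-- Eventually, the windows of density close to `p i` belong to stage `i`. -/
lemma eventually_stage_eq (hM0 : ∀ N, M N 0 = 0)
    (hmono : ∀ N, l ≤ N → ∀ i < l, M N i ≤ M N (i + 1))
    (hMconv : ∀ i ≤ l, Tendsto (fun N => (M N i : ℝ) / N) atTop (𝓝 (r i)))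
    {i : ℕ} (hi : i ≤ l) {q η : ℝ} (hlo : r i < q - η) (hhi : i < l → q + η < r (i + 1)) :
    ∀ᶠ N : ℕ in atTop, ∀ c : ℕ, |(c : ℝ) / N - q| < η → stage l (M N) c = i := by
  have hhi' : ∀ᶠ N : ℕ in atTop, i < l → q + η < (M N (i + 1) : ℝ) / N := by
    by_cases hil : i < l
    · filter_upwards [(hMconv (i + 1) hil).eventually_const_lt (hhi hil)] with N h _ using h
    · exact Eventually.of_forall fun N h => absurd h hil
  filter_upwards [eventually_ge_atTop l, eventually_gt_atTop 0,
    (hMconv i hi).eventually_lt_const hlo, hhi'] with N hN hN0 h1 h2 c hc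
  have hNR : (0 : ℝ) < N := by positivity
  obtain ⟨hc1, hc2⟩ := abs_lt.1 hc
  refine stage_eq (hM0 N) (hmono N hN) hi ?_ fun hil => ?_
  · have : (M N i : ℝ) / N < (c : ℝ) / N := by linarith
    exact (Nat.cast_lt.1 ((div_lt_div_iff_of_pos_right hNR).1 this)).le
  · have := h2 hil
    have : (c : ℝ) / N < (M N (i + 1) : ℝ) / N := by linarith
    exact Nat.cast_lt.1 ((div_lt_div_iff_of_pos_right hNR).1 this)

end Asymptotics

lemma abs_windowCount_sub_le (N j : ℕ) (e : ℕ → Bool) :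
    |(windowCount N e j : ℝ) - windowCount N e 0| ≤ j := by
  have key : ∀ j, windowCount N e (j + 1) + (e j).toNat =
      windowCount N e j + (e (j + N)).toNat := by
    intro j
    rw [windowCount_eq_sum, windowCount_eq_sum,
      ← Finset.sum_range_succ (fun k => (e (j + k)).toNat),
      Finset.sum_range_succ']
    simp only [add_zero, add_assoc, add_comm 1]
  induction j with
  | zero => simp
  | succ j ih =>
    have h := key j
    have h1 := Bool.toNat_le (e j)
    have h2 := Bool.toNat_le (e (j + N))
    have ha : (windowCount N e (j + 1) : ℝ) ≤ windowCount N e j + 1 := by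
      exact_mod_cast (by omega : windowCount N e (j + 1) ≤ windowCount N e j + 1)
    have hb : (windowCount N e j : ℝ) ≤ windowCount N e (j + 1) + 1 := by
      exact_mod_cast (by omega : windowCount N e j ≤ windowCount N e (j + 1) + 1)
    rw [abs_le] at ih ⊢
    push_cast
    constructor <;> linarith [ih.1, ih.2]

lemma prod_bitProb (q : ℝ) (m : ℕ) (e : ℕ → Bool) :
    ∏ k ∈ Finset.range m, bitProb q (e k) =
      q ^ ((Finset.range m).filter (fun k => e k = true)).card *
        (1 - q) ^ ((Finset.range m).filter (fun k => e k = false)).card := by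
  simp only [bitProb]
  rw [Finset.prod_ite, Finset.prod_const, Finset.prod_const]
  simp only [Bool.not_eq_true]

/-- If all windows outside `far` use the success probability `q` during `m` steps, the law of
the next `m` entries is within `P(far)` of the Bernoulli law. -/
lemma IsWindowChain.abs_cylProb_sub_le {N : ℕ} {f : ℕ → ℝ} {μ : Measure (ℕ → Bool)}
    [IsProbabilityMeasure μ] (h : IsWindowChain N f μ) (h0 : ∀ c, 0 ≤ f c) (h1 : ∀ c, f c ≤ 1)
    {q : ℝ} (hq0 : 0 ≤ q) (hq1 : q ≤ 1) (t m : ℕ) (e : ℕ → Bool) (far : Finset ℕ → Prop)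
    [DecidablePred far] (hnear : ∀ A ⊆ Finset.range N, ¬ far A → ∀ j < m,
      f (windowCount N (blockSeq A N e) j) = q) :
    |cylProb μ (t + N) m e - ∏ k ∈ Finset.range m, bitProb q (e k)| ≤
      ∑ A ∈ (Finset.range N).powerset.filter far, cylProb μ t N (blockSeq A N e) := by
  have hentry : ∀ A j, blockSeq A N e (N + j) = e j := fun A j => by simp [blockSeq]
  have hsub : cylProb μ (t + N) m e - ∏ k ∈ Finset.range m, bitProb q (e k) =
      ∑ A ∈ (Finset.range N).powerset, cylProb μ t N (blockSeq A N e) *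
        (∏ k ∈ Finset.range m, bitProb (f (windowCount N (blockSeq A N e) k)) (e k) -
          ∏ k ∈ Finset.range m, bitProb q (e k)) := by
    rw [cylProb_add_left]
    simp only [mul_sub, Finset.sum_sub_distrib, h.cylProb_add, hentry]
    rw [← Finset.sum_mul, sum_cylProb, one_mul]
  rw [hsub, Finset.sum_filter]
  refine (Finset.abs_sum_le_sum_abs _ _).trans (Finset.sum_le_sum fun A hA => ?_)
  rw [abs_mul, abs_of_nonneg (cylProb_nonneg _ _ _ _)]
  by_cases hf : far A
  · rw [if_pos hf]
    refine mul_le_of_le_one_right (cylProb_nonneg _ _ _ _) (abs_le.2 ⟨?_, ?_⟩)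
    all_goals
      have a0 := Finset.prod_nonneg fun k (_ : k ∈ Finset.range m) =>
        bitProb_nonneg (h0 (windowCount N (blockSeq A N e) k)) (h1 _) (e k)
      have a1 := Finset.prod_le_one (fun k (_ : k ∈ Finset.range m) =>
        bitProb_nonneg (h0 (windowCount N (blockSeq A N e) k)) (h1 _) (e k))
        (fun k _ => bitProb_le_one (h0 _) (h1 _) (e k))
      have b0 := Finset.prod_nonneg fun k (_ : k ∈ Finset.range m) =>
        bitProb_nonneg hq0 hq1 (e k)
      have b1 := Finset.prod_le_one (fun k (_ : k ∈ Finset.range m) =>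
        bitProb_nonneg hq0 hq1 (e k)) (fun k _ => bitProb_le_one hq0 hq1 (e k))
      linarith
  · rw [if_neg hf, Finset.prod_congr rfl fun k hk => by
      rw [hnear A (Finset.mem_powerset.1 hA) hf k (Finset.mem_range.1 hk)]]
    simp

lemma stepProbMulti_add (N l : ℕ) (M : ℕ → ℕ) (p : ℕ → ℝ) (e : ℕ → Bool) (j : ℕ) :
    stepProbMulti N l M p e (N + j) =
      bitProb (p (stage l M (windowCount N e j))) (e (N + j)) := by
  simp [stepProbMulti, bitProb, windowCount, add_comm j N]

lemma isWindowChain_of_cylinder {N l : ℕ} {M : ℕ → ℕ} {p : ℕ → ℝ} {μ : Measure (ℕ → Bool)}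
    (hp0 : ∀ i ≤ l, 0 ≤ p i) (hp1 : ∀ i ≤ l, p i ≤ 1)
    (hμ : ∀ (n : ℕ) (e : ℕ → Bool), μ {ω | ∀ k < n, ω k = e k} =
        ENNReal.ofReal (∏ k ∈ Finset.range n, stepProbMulti N l M p e k)) :
    IsWindowChain N (fun c => p (stage l M c)) μ := by
  have hcyl : ∀ n e, cylProb μ 0 n e = ∏ k ∈ Finset.range n, stepProbMulti N l M p e k := by
    intro n e
    simp only [cylProb, zero_add]
    rw [hμ, ENNReal.toReal_ofReal]
    refine Finset.prod_nonneg fun k _ => ?_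
    change 0 ≤ bitProb (if k < N then p 0 else _) (e k)
    split_ifs
    · exact bitProb_nonneg (hp0 0 (Nat.zero_le l)) (hp1 0 (Nat.zero_le l)) (e k)
    · exact bitProb_nonneg (hp0 _ (stage_le _)) (hp1 _ (stage_le _)) (e k)
  intro j e
  rw [hcyl, hcyl, Finset.prod_range_succ, stepProbMulti_add]

/-- Theorem 1.5: under the unique-argmax condition, there are deterministic times
`T_N → ∞` such that the increments of the walk after time `N + T_N` converge
weakly to those of a simple random walk with right-jump probability `p_{i₀}`.
The increment `X_{N+T_N+k+1} - X_{N+T_N+k}` equals `+1` exactly when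
`ω (N + T_N + k) = true`. -/
theorem weak_convergence_to_simple_rw (l : ℕ) (hl : 1 ≤ l)
    (p : ℕ → ℝ) (hp0 : 0 < p 0) (hpmono : ∀ i < l, p i < p (i + 1)) (hpl : p l < 1)
    (r : ℕ → ℝ) (hr0 : r 0 = 0) (hrtop : r (l + 1) = 1)
    (hrmem : ∀ i, 1 ≤ i → i ≤ l → r i ∈ Set.Icc (0 : ℝ) 1)
    (hrmono : ∀ i, 1 ≤ i → i < l → r i ≤ r (i + 1))
    (i0 : ℕ) (hi0l : i0 ≤ l) (hi0lo : r i0 < p i0) (hi0hi : p i0 < r (i0 + 1))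
    (hargmax : ∀ i ≤ l, r i < p i → p i < r (i + 1) → i ≠ i0 →
      Jfun p r i < Jfun p r i0)
    (M : ℕ → ℕ → ℕ)
    (hMvalid : ∀ N, l ≤ N → 1 ≤ M N 1 ∧
      (∀ i, 1 ≤ i → i < l → M N i < M N (i + 1)) ∧ M N l ≤ N)
    (hM0 : ∀ N, M N 0 = 0) (hMtop : ∀ N, M N (l + 1) = N + 1)
    (hMconv : ∀ i, 1 ≤ i → i ≤ l →
      Tendsto (fun N => (M N i : ℝ) / N) atTop (𝓝 (r i)))
    (μ : ℕ → Measure (ℕ → Bool)) (hμprob : ∀ N, IsProbabilityMeasure (μ N))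
    (hμ : ∀ N, l ≤ N → ∀ (n : ℕ) (e : ℕ → Bool),
      μ N {ω | ∀ k < n, ω k = e k} =
        ENNReal.ofReal (∏ k ∈ Finset.range n, stepProbMulti N l (M N) p e k)) :
    ∃ T : ℕ → ℕ, Tendsto T atTop atTop ∧
      ∀ m : ℕ, 1 ≤ m → ∀ e : ℕ → Bool,
        Tendsto (fun N => (μ N {ω | ∀ k < m, ω (N + T N + k) = e k}).toReal)
          atTop
          (𝓝 (p i0 ^ ((Finset.range m).filter (fun k => e k = true)).card *
            (1 - p i0) ^ ((Finset.range m).filter (fun k => e k = false)).card)) := by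
  have hpm : ∀ j ≤ l, ∀ i ≤ j, p i ≤ p j := by
    intro j
    induction j with
    | zero =>
      intro _ i hi
      rw [Nat.le_zero.1 hi]
    | succ j ih =>
      intro hj i hi
      rcases Nat.le_succ_iff.1 hi with h | rfl
      · exact (ih (by omega) i h).trans (hpmono j hj).le
      · exact le_rfl
  obtain ⟨δ, hδ, hδ0, hδ1⟩ : ∃ δ > 0, δ ≤ p 0 ∧ p l ≤ 1 - δ :=
    ⟨min (p 0) (1 - p l), lt_min hp0 (sub_pos.2 hpl), min_le_left _ _, by
      linarith [min_le_right (p 0) (1 - p l)]⟩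
  have hpδ0 : ∀ i ≤ l, δ ≤ p i := fun i hi => hδ0.trans (hpm i hi 0 (Nat.zero_le i))
  have hpδ1 : ∀ i ≤ l, p i ≤ 1 - δ := fun i hi => (hpm l le_rfl i hi).trans hδ1
  have hq0 : ∀ i ≤ l, 0 < p i := fun i hi => hδ.trans_le (hpδ0 i hi)
  have hq1 : ∀ i ≤ l, p i < 1 := fun i hi => by linarith [hpδ1 i hi]
  have hmono : ∀ N, l ≤ N → ∀ i < l, M N i ≤ M N (i + 1) := by
    intro N hN i hi
    rcases Nat.eq_zero_or_pos i with rfl | hpos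
    · rw [hM0]
      exact Nat.zero_le _
    · exact ((hMvalid N hN).2.1 i hpos hi).le
  have hMN : ∀ N, l ≤ N → ∀ i ≤ l, M N i ≤ N := by
    intro N hN i hi
    induction hi using Nat.decreasingInduction with
    | self => exact (hMvalid N hN).2.2
    | of_succ k hk ih => exact (hmono N hN k hk).trans ih
  have hconv : ∀ i ≤ l, Tendsto (fun N => (M N i : ℝ) / N) atTop (𝓝 (r i)) := by
    intro i hi
    rcases Nat.eq_zero_or_pos i with rfl | hpos
    · simp [hM0, hr0]
    · exact hMconv i hpos hi
  have hchain : ∀ N, l ≤ N → IsWindowChain N (fun c => p (stage l (M N) c)) (μ N) := fun N hN =>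
    isWindowChain_of_cylinder (fun i hi => (hq0 i hi).le) (fun i hi => (hq1 i hi).le) (hμ N hN)
  have hT : ∀ N, ∃ t ≥ N, l ≤ N → ∀ e, cylProb (μ N) t N e ≤
      2 / (∑ A ∈ (Finset.range N).powerset,
        windowWeight (fun c => p (stage l (M N) c)) A.card) *
        windowWeight (fun c => p (stage l (M N) c)) (windowCount N e 0) := by
    intro N
    by_cases hN : l ≤ N
    · have := hμprob N
      have hc := hchain N hN
      obtain ⟨n, rfl⟩ : ∃ n, N = n + 1 := ⟨N - 1, by omega⟩
      obtain ⟨t, ht, hle⟩ := hc.exists_cylProb_le_two hδ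
        (fun c => hpδ0 _ (stage_le c)) (fun c => hpδ1 _ (stage_le c)) (n + 1)
      exact ⟨t, ht, fun _ => hle⟩
    · exact ⟨N, le_rfl, fun h => absurd h hN⟩
  choose T hTge hTle using hT
  refine ⟨T, tendsto_atTop_mono hTge tendsto_id, fun m _ e => ?_⟩
  obtain ⟨ε, hε, hεlo, hεhi⟩ : ∃ ε > 0, r i0 < p i0 - 2 * ε ∧ p i0 + 2 * ε < r (i0 + 1) := by
    refine ⟨min (p i0 - r i0) (r (i0 + 1) - p i0) / 4, by
      have := lt_min (sub_pos.2 hi0lo) (sub_pos.2 hi0hi)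
      positivity, ?_, ?_⟩
    · linarith [min_le_left (p i0 - r i0) (r (i0 + 1) - p i0)]
    · linarith [min_le_right (p i0 - r i0) (r (i0 + 1) - p i0)]
  have hβ : Tendsto (fun N : ℕ => 1 / ((N : ℝ) * ε ^ 2)) atTop (𝓝 0) := by
    have := (tendsto_one_div_atTop_nhds_zero_nat (𝕜 := ℝ)).div_const (ε ^ 2)
    simpa only [div_div, zero_div] using this
  have hbound : Tendsto (fun N : ℕ => 2 * (1 / δ * (∑ i ∈ (Finset.range (l + 1)).erase i0,
        stageMass N l (M N) p i / stageMass N l (M N) p i0 + 1 / ((N : ℝ) * ε ^ 2)) /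
      (1 - 1 / ((N : ℝ) * ε ^ 2)))) atTop (𝓝 0) := by
    have hsum : Tendsto (fun N : ℕ => ∑ i ∈ (Finset.range (l + 1)).erase i0,
        stageMass N l (M N) p i / stageMass N l (M N) p i0) atTop (𝓝 0) := by
      rw [← Finset.sum_const_zero (s := (Finset.range (l + 1)).erase i0)]
      refine tendsto_finsetSum _ fun i hi => ?_
      obtain ⟨hne, hi⟩ := Finset.mem_erase.1 hi
      have hil : i ≤ l := Nat.lt_succ_iff.1 (Finset.mem_range.1 hi)
      exact tendsto_stageMass_ratio hq0 hq1 hM0 hmono hMN hconv hil hi0l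
        (Jfun_lt_of_admissible_argmax hq0 hq1 hpmono hr0 hrtop hrmem hi0l hargmax hil hne)
    have := (((hsum.add hβ).const_mul (1 / δ)).div (hβ.const_sub 1) (by norm_num)).const_mul 2
    simpa using this
  rw [← prod_bitProb, tendsto_iff_dist_tendsto_zero]
  refine squeeze_zero' (Eventually.of_forall fun N => dist_nonneg) ?_ hbound
  have hm : ∀ᶠ N : ℕ in atTop, (m : ℝ) / N < ε :=
    (tendsto_const_div_atTop_nhds_zero_nat (m : ℝ)).eventually_lt_const hε
  filter_upwards [eventually_ge_atTop l, hm, hβ.eventually_lt_const one_pos,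
    eventually_stage_eq hM0 hmono hconv hi0l hεlo fun _ => hεhi] with N hN hmN hβN hstage
  have := hμprob N
  have hN0 : N ≠ 0 := by omega
  have hNR : (0 : ℝ) < N := by positivity
  have hfar := far_mass_le hN0 (hM0 N) hδ hε hpδ0 hpδ1 hi0l
    (fun c _ hc => hstage c (hc.trans (by linarith))) hβN
  rw [Real.dist_eq, add_comm N (T N)]
  refine ((hchain N hN).abs_cylProb_sub_le (fun c => (hq0 _ (stage_le c)).le)
    (fun c => (hq1 _ (stage_le c)).le) (hq0 i0 hi0l).le (hq1 i0 hi0l).le (T N) m e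
    (fun A => ε ≤ |(A.card : ℝ) / N - p i0|) fun A hA hnear j hj => ?_).trans ?_
  · have hshift := abs_windowCount_sub_le N j (blockSeq A N e)
    rw [windowCount_blockSeq hA] at hshift
    have hjm : (j : ℝ) / N < ε := lt_of_le_of_lt (by gcongr) hmN
    have hdiv : |(windowCount N (blockSeq A N e) j : ℝ) / N - (A.card : ℝ) / N| < ε := by
      rw [← sub_div, abs_div, abs_of_pos hNR]
      exact lt_of_le_of_lt (by gcongr) hjm
    have hst := hstage (windowCount N (blockSeq A N e) j) (by
      have := abs_sub_le ((windowCount N (blockSeq A N e) j : ℝ) / N) ((A.card : ℝ) / N) (p i0)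
      linarith [not_le.1 hnear])
    simp only [hst]
  · refine le_trans ?_ (mul_le_mul_of_nonneg_left hfar zero_le_two)
    rw [mul_div_assoc', mul_div_right_comm, Finset.mul_sum]
    refine Finset.sum_le_sum fun A hA => ?_
    have := hTle N hN (blockSeq A N e)
    rwa [windowCount_blockSeq (Finset.mem_powerset.1 (Finset.mem_filter.1 hA).1)] at this
end

section
/- Let G : [0,1] → (0,1) be continuous and nondecreasing, and define F(p) = ∫_0^p log( G(x)/(1−G(x)) ) dx − p log p − (1−p) log(1−p) for 0 < p < 1 (extended continuously to [0,1]). Then F attains a maximum on [0,1], and any point p at which F attains its maximum satisfies G(p) = p. In particular, if G has a unique fixed point then F attains its maximum at a unique point. -/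
/-- The function `F(p) = ∫_0^p log(G(x)/(1-G(x))) dx - p log p - (1-p) log(1-p)`.
Since `Real.log 0 = 0` in Mathlib, this expression automatically realizes the
continuous extension to `p = 0` and `p = 1`. -/
noncomputable def Ffun (G : ℝ → ℝ) (p : ℝ) : ℝ :=
  (∫ x in (0 : ℝ)..p, Real.log (G x / (1 - G x))) -
    p * Real.log p - (1 - p) * Real.log (1 - p)

open Set

theorem Ffun_eq_integral_add_binEntropy (G : ℝ → ℝ) (p : ℝ) :
    Ffun G p = (∫ x in (0 : ℝ)..p, Real.log (G x / (1 - G x))) + Real.binEntropy p := by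
  simp only [Ffun, Real.binEntropy, Real.log_inv]
  ring

theorem continuousOn_log_odds {G : ℝ → ℝ} {s : Set ℝ} (hGmap : ∀ x ∈ s, G x ∈ Ioo (0 : ℝ) 1)
    (hGcont : ContinuousOn G s) :
    ContinuousOn (fun x => Real.log (G x / (1 - G x))) s := by
  have h (x : ℝ) (hx : x ∈ s) : 1 - G x ≠ 0 := (sub_pos.2 (hGmap x hx).2).ne'
  exact (hGcont.div (continuousOn_const.sub hGcont) h).log
    fun x hx => div_ne_zero (hGmap x hx).1.ne' (h x hx)

theorem continuousOn_Ffun {G : ℝ → ℝ} (hGmap : ∀ x ∈ Icc (0 : ℝ) 1, G x ∈ Ioo (0 : ℝ) 1)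
    (hGcont : ContinuousOn G (Icc (0 : ℝ) 1)) : ContinuousOn (Ffun G) (Icc 0 1) := by
  rw [funext (Ffun_eq_integral_add_binEntropy G)]
  refine ContinuousOn.add ?_ Real.binEntropy_continuous.continuousOn
  have h := intervalIntegral.continuousOn_primitive_interval (μ := MeasureTheory.volume)
    (a := (0 : ℝ)) (b := 1) (f := fun x => Real.log (G x / (1 - G x)))
  rw [uIcc_of_le zero_le_one] at h
  exact h (continuousOn_log_odds hGmap hGcont).integrableOn_Icc

theorem hasDerivAt_Ffun {G : ℝ → ℝ} (hGmap : ∀ x ∈ Icc (0 : ℝ) 1, G x ∈ Ioo (0 : ℝ) 1)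
    (hGcont : ContinuousOn G (Icc (0 : ℝ) 1)) {p : ℝ} (hp : p ∈ Ioo (0 : ℝ) 1) :
    HasDerivAt (Ffun G)
      ((Real.log (G p) - Real.log (1 - G p)) - (Real.log p - Real.log (1 - p))) p := by
  have hc := continuousOn_log_odds hGmap hGcont
  have hGp := hGmap p (Ioo_subset_Icc_self hp)
  have hint : IntervalIntegrable (fun x => Real.log (G x / (1 - G x))) MeasureTheory.volume 0 p :=
    ContinuousOn.intervalIntegrable (hc.mono (by
      rw [uIcc_of_le hp.1.le]
      exact Icc_subset_Icc_right hp.2.le))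
  have hd := intervalIntegral.integral_hasDerivAt_right hint
    ((hc.mono Ioo_subset_Icc_self).stronglyMeasurableAtFilter isOpen_Ioo p hp)
    (hc.continuousAt (Icc_mem_nhds hp.1 hp.2))
  rw [funext (Ffun_eq_integral_add_binEntropy G)]
  refine (hd.add (Real.hasDerivAt_binEntropy hp.1.ne' hp.2.ne)).congr_deriv ?_
  rw [Real.log_div hGp.1.ne' (sub_pos.2 hGp.2).ne']
  ring

theorem log_sub_log_one_sub_strictMonoOn :
    StrictMonoOn (fun x : ℝ => Real.log x - Real.log (1 - x)) (Ioo 0 1) := by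
  intro x hx y hy hxy
  have h₁ := Real.log_lt_log hx.1 hxy
  have h₂ := Real.log_lt_log (sub_pos.2 hy.2) (sub_lt_sub_left hxy 1)
  simp only
  linarith

theorem eq_of_isMaxOn_Ffun {G : ℝ → ℝ} (hGmap : ∀ x ∈ Icc (0 : ℝ) 1, G x ∈ Ioo (0 : ℝ) 1)
    (hGcont : ContinuousOn G (Icc (0 : ℝ) 1)) (hGmono : MonotoneOn G (Icc (0 : ℝ) 1))
    {p : ℝ} (hp : p ∈ Icc (0 : ℝ) 1) (hmax : IsMaxOn (Ffun G) (Icc 0 1) p) : G p = p := by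
  have hF := continuousOn_Ffun hGmap hGcont
  have h0 : (0 : ℝ) ∈ Icc (0 : ℝ) 1 := by simp
  have h1 : (1 : ℝ) ∈ Icc (0 : ℝ) 1 := by simp
  rcases hp.1.eq_or_lt with rfl | hp0
  · have hG := hGmap 0 h0
    have hmono : StrictMonoOn (Ffun G) (Icc 0 (G 0)) := by
      refine strictMonoOn_of_deriv_pos (convex_Icc _ _)
        (hF.mono (Icc_subset_Icc_right hG.2.le)) fun x hx => ?_
      rw [interior_Icc] at hx
      have hx' : x ∈ Ioo (0 : ℝ) 1 := ⟨hx.1, hx.2.trans hG.2⟩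
      have hxI := Ioo_subset_Icc_self hx'
      rw [(hasDerivAt_Ffun hGmap hGcont hx').deriv, sub_pos]
      exact log_sub_log_one_sub_strictMonoOn hx' (hGmap x hxI)
        (hx.2.trans_le (hGmono h0 hxI hx.1.le))
    exact absurd (hmax ⟨hG.1.le, hG.2.le⟩)
      (hmono (left_mem_Icc.2 hG.1.le) (right_mem_Icc.2 hG.1.le) hG.1).not_ge
  rcases hp.2.eq_or_lt with rfl | hp1
  · have hG := hGmap 1 h1
    have hanti : StrictAntiOn (Ffun G) (Icc (G 1) 1) := by
      refine strictAntiOn_of_deriv_neg (convex_Icc _ _)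
        (hF.mono (Icc_subset_Icc_left hG.1.le)) fun x hx => ?_
      rw [interior_Icc] at hx
      have hx' : x ∈ Ioo (0 : ℝ) 1 := ⟨hG.1.trans hx.1, hx.2⟩
      have hxI := Ioo_subset_Icc_self hx'
      rw [(hasDerivAt_Ffun hGmap hGcont hx').deriv, sub_neg]
      exact log_sub_log_one_sub_strictMonoOn (hGmap x hxI) hx'
        ((hGmono hxI h1 hx.2.le).trans_lt hx.1)
    exact absurd (hmax ⟨hG.1.le, hG.2.le⟩)
      (hanti (left_mem_Icc.2 hG.2.le) (right_mem_Icc.2 hG.2.le) hG.2).not_ge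
  exact log_sub_log_one_sub_strictMonoOn.injOn (hGmap p hp) ⟨hp0, hp1⟩ <| sub_eq_zero.1 <|
    (hmax.isLocalMax (Icc_mem_nhds hp0 hp1)).hasDerivAt_eq_zero
      (hasDerivAt_Ffun hGmap hGcont ⟨hp0, hp1⟩)

/-- Part of Theorem 1.6: for continuous nondecreasing `G : [0,1] → (0,1)`, the
function `F` attains a maximum on `[0,1]`, every maximizer of `F` is a fixed point
of `G`, and if `G` has a unique fixed point then `F` has a unique maximizer. -/
theorem Ffun_max_is_fixed_point (G : ℝ → ℝ)
    (hGmap : ∀ x ∈ Set.Icc (0 : ℝ) 1, G x ∈ Set.Ioo (0 : ℝ) 1)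
    (hGcont : ContinuousOn G (Set.Icc (0 : ℝ) 1))
    (hGmono : MonotoneOn G (Set.Icc (0 : ℝ) 1)) :
    (∃ pm ∈ Set.Icc (0 : ℝ) 1, ∀ q ∈ Set.Icc (0 : ℝ) 1, Ffun G q ≤ Ffun G pm) ∧
    (∀ pm ∈ Set.Icc (0 : ℝ) 1,
      (∀ q ∈ Set.Icc (0 : ℝ) 1, Ffun G q ≤ Ffun G pm) → G pm = pm) ∧
    ((∃! x, x ∈ Set.Ioo (0 : ℝ) 1 ∧ G x = x) →
      ∃! pm, pm ∈ Set.Icc (0 : ℝ) 1 ∧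
        ∀ q ∈ Set.Icc (0 : ℝ) 1, Ffun G q ≤ Ffun G pm) := by
  have hex : ∃ pm ∈ Set.Icc (0 : ℝ) 1, ∀ q ∈ Set.Icc (0 : ℝ) 1, Ffun G q ≤ Ffun G pm :=
    isCompact_Icc.exists_isMaxOn (nonempty_Icc.2 zero_le_one) (continuousOn_Ffun hGmap hGcont)
  have hfix (pm : ℝ) (hpm : pm ∈ Set.Icc (0 : ℝ) 1)
      (hmax : ∀ q ∈ Set.Icc (0 : ℝ) 1, Ffun G q ≤ Ffun G pm) : G pm = pm :=
    eq_of_isMaxOn_Ffun hGmap hGcont hGmono hpm hmax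
  refine ⟨hex, hfix, fun huniq => ?_⟩
  have hfixed (pm : ℝ) (hpm : pm ∈ Set.Icc (0 : ℝ) 1)
      (hmax : ∀ q ∈ Set.Icc (0 : ℝ) 1, Ffun G q ≤ Ffun G pm) :
      pm ∈ Set.Ioo (0 : ℝ) 1 ∧ G pm = pm :=
    have h := hfix pm hpm hmax
    ⟨h ▸ hGmap pm hpm, h⟩
  obtain ⟨pm, hpm, hmax⟩ := hex
  exact ⟨pm, ⟨hpm, hmax⟩, fun q hq =>
    huniq.unique (hfixed q hq.1 hq.2) (hfixed pm hpm hmax)⟩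
end

section
/- Let G : [0,1] → (0,1) be continuous and nondecreasing, define F(p) = ∫_0^p log( G(x)/(1−G(x)) ) dx − p log p − (1−p) log(1−p), and suppose F attains its maximum on [0,1] uniquely at p*. Define s(N;G) = [ Σ_{i=0}^{N} (1/(1−G(i/N))) ( ∏_{k=1}^{i} G((k−1)/N)/(1−G((k−1)/N)) ) C(N,i) (2i/N − 1) ] / [ Σ_{i=0}^{N} (1/(1−G(i/N))) ( ∏_{k=1}^{i} G((k−1)/N)/(1−G((k−1)/N)) ) C(N,i) ]. Then lim_{N→∞} s(N;G) = 2p* − 1. -/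
open Filter Finset Topology

/-- The speed `s(N;G)` of the random walk excited by its recent history with history
window `N` and `N` threshold levels `Mᵢ = i`, `pᵢ = G(i/N)`. -/
noncomputable def speedG (N : ℕ) (G : ℝ → ℝ) : ℝ :=
  (∑ i ∈ Finset.range (N + 1), (1 / (1 - G ((i : ℝ) / N))) *
      (∏ k ∈ Finset.Icc 1 i, G (((k : ℝ) - 1) / N) / (1 - G (((k : ℝ) - 1) / N))) *
      (N.choose i) * (2 * (i : ℝ) / N - 1)) /
  (∑ i ∈ Finset.range (N + 1), (1 / (1 - G ((i : ℝ) / N))) *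
      (∏ k ∈ Finset.Icc 1 i, G (((k : ℝ) - 1) / N) / (1 - G (((k : ℝ) - 1) / N))) *
      (N.choose i))

lemma abs_log_factorial_sub_le (n : ℕ) :
    |Real.log n.factorial - (n * Real.log n - n)| ≤ 1 + Real.log (n + 1) := by
  have key : (n * Real.log n - n ≤ Real.log n.factorial) ∧
      Real.log n.factorial ≤ n * Real.log n - n + 1 + Real.log n := by
    induction n with
    | zero => simp
    | succ n ih =>
      have h1 : (0 : ℝ) < n + 1 := by positivity
      have hfac : Real.log (n + 1).factorial = Real.log (n + 1) + Real.log n.factorial := by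
        rw [Nat.factorial_succ, Nat.cast_mul, Real.log_mul (by positivity) (by positivity)]
        push_cast; rfl
      rcases Nat.eq_zero_or_pos n with rfl | hn
      · simp
      have hn' : (0 : ℝ) < n := by exact_mod_cast hn
      have lower : n * (Real.log (n + 1) - Real.log n) ≤ 1 := by
        have := Real.log_le_sub_one_of_pos (div_pos h1 hn')
        rw [Real.log_div h1.ne' hn'.ne'] at this
        calc _ ≤ n * (((n : ℝ) + 1) / n - 1) := by gcongr
          _ = 1 := by field_simp; ring
      have upper : 1 ≤ (n + 1) * (Real.log (n + 1) - Real.log n) := by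
        have := Real.log_le_sub_one_of_pos (div_pos hn' h1)
        rw [Real.log_div hn'.ne' h1.ne'] at this
        have : (n + 1 : ℝ) * (Real.log n - Real.log (n + 1)) ≤
            (n + 1) * ((n : ℝ) / (n + 1) - 1) := by gcongr
        have e : (n + 1 : ℝ) * ((n : ℝ) / (n + 1) - 1) = -1 := by field_simp; ring
        linarith
      rw [hfac]
      push_cast
      constructor
      · linarith [ih.1]
      · linarith [ih.2]
  have : Real.log n ≤ Real.log ((n : ℝ) + 1) := by
    rcases Nat.eq_zero_or_pos n with rfl | hn
    · simp
    · exact Real.log_le_log (by exact_mod_cast hn) (by linarith)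
  have : 0 ≤ Real.log ((n : ℝ) + 1) := Real.log_nonneg (by simp)
  rw [abs_le]
  constructor <;> linarith [key.1, key.2]

lemma abs_log_choose_sub_le {N i : ℕ} (hN : 0 < N) (hi : i ≤ N) :
    |Real.log (N.choose i) - N * (-((i : ℝ) / N * Real.log (i / N)) -
      (1 - (i : ℝ) / N) * Real.log (1 - i / N))| ≤ 3 + 3 * Real.log (N + 1) := by
  obtain ⟨j, rfl⟩ := Nat.exists_eq_add_of_le hi
  have hN' : ((i : ℝ) + j) ≠ 0 := by exact_mod_cast hN.ne'
  have hlog : Real.log ((i + j).choose i) =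
      Real.log (i + j).factorial - Real.log i.factorial - Real.log j.factorial := by
    rw [Nat.cast_choose ℝ hi, Nat.add_sub_cancel_left,
      Real.log_div (by positivity) (by positivity), Real.log_mul (by positivity) (by positivity)]
    ring
  have hmul (k : ℕ) : (k : ℝ) * Real.log (k / (i + j)) = k * (Real.log k - Real.log (i + j)) := by
    rcases Nat.eq_zero_or_pos k with rfl | hk
    · simp
    · rw [Real.log_div (by positivity) hN']
  have hent : ((i : ℝ) + j) * (-((i : ℝ) / (i + j) * Real.log (i / (i + j))) -
      (1 - (i : ℝ) / (i + j)) * Real.log (1 - i / (i + j))) =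
      ((i + j) * Real.log (i + j) - (i + j)) - (i * Real.log i - i) - (j * Real.log j - j) := by
    have e : 1 - (i : ℝ) / (i + j) = j / (i + j) := by field_simp; ring
    rw [e]
    calc _ = -((i : ℝ) * Real.log (i / (i + j))) - j * Real.log (j / (i + j)) := by field_simp
      _ = _ := by rw [hmul, hmul]; ring
  have hi' : Real.log ((i : ℝ) + 1) ≤ Real.log (i + j + 1) := by gcongr; simp
  have hj' : Real.log ((j : ℝ) + 1) ≤ Real.log (i + j + 1) := by gcongr; simp
  have h1 := abs_le.1 (abs_log_factorial_sub_le (i + j))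
  have h2 := abs_le.1 (abs_log_factorial_sub_le i)
  have h3 := abs_le.1 (abs_log_factorial_sub_le j)
  push_cast at h1 ⊢
  rw [hent, hlog, abs_le]
  constructor <;> linarith [h1.1, h1.2, h2.1, h2.2, h3.1, h3.2]

lemma MonotoneOn.abs_sum_sub_integral_le {g : ℝ → ℝ} (hg : MonotoneOn g (Set.Icc 0 1))
    {N i : ℕ} (hN : 0 < N) (hi : i ≤ N) :
    |∑ k ∈ range i, g ((k : ℝ) / N) - N * ∫ x in (0 : ℝ)..i / N, g x| ≤ g 1 - g 0 := by
  have hN' : (0 : ℝ) < N := by exact_mod_cast hN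
  have hi' : (i : ℝ) ≤ N := by exact_mod_cast hi
  have hmem : ∀ {x : ℝ}, x ∈ Set.Icc (0 : ℝ) (0 + i) → x / N ∈ Set.Icc (0 : ℝ) 1 := fun hx =>
    ⟨div_nonneg hx.1 hN'.le, (div_le_one hN').2 (by linarith [hx.2])⟩
  have hmono : MonotoneOn (fun x => g (x / N)) (Set.Icc (0 : ℝ) (0 + i)) := fun x hx y hy hxy =>
    hg (hmem hx) (hmem hy) (by gcongr)
  have hint : ∫ x in (0 : ℝ)..0 + i, g (x / N) = N * ∫ x in (0 : ℝ)..i / N, g x := by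
    rw [intervalIntegral.integral_comp_div _ hN'.ne']
    simp
  have lower := hmono.sum_le_integral
  have upper := hmono.integral_le_sum
  rw [hint] at lower upper
  have htel := Finset.sum_range_sub (fun k : ℕ => g ((k : ℝ) / N)) i
  rw [Finset.sum_sub_distrib] at htel
  simp only [zero_add, Nat.cast_zero, zero_div] at lower upper htel
  have hend : g ((i : ℝ) / N) ≤ g 1 :=
    hg (hmem (by simp)) (by simp) ((div_le_one hN').2 hi')
  rw [abs_le]
  have h0 : g 0 ≤ g 1 := hg (by simp) (by simp) zero_le_one
  constructor <;> linarith

lemma tendsto_pow_mul_exp_neg_mul_atTop {c : ℝ} (hc : 0 < c) (n : ℕ) :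
    Tendsto (fun N : ℕ => ((N : ℝ) + 1) ^ n * Real.exp (-(c * N))) atTop (𝓝 0) := by
  have hlin : Tendsto (fun N : ℕ => c * ((N : ℝ) + 1)) atTop atTop :=
    (tendsto_atTop_add_const_right _ _ tendsto_natCast_atTop_atTop).const_mul_atTop hc
  have := ((Real.tendsto_pow_mul_exp_neg_atTop_nhds_zero n).comp hlin).const_mul
    (Real.exp c / c ^ n)
  rw [mul_zero] at this
  refine this.congr fun N => ?_
  have e : Real.exp (-(c * N)) = Real.exp c * Real.exp (-(c * (N + 1))) := by
    rw [← Real.exp_add]; ring_nf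
  simp only [Function.comp_apply, mul_pow]
  rw [e]
  field_simp

/-- Laplace's principle: weights of exponential order `exp (N * F (i / N))`, up to a polynomial
factor, concentrate at the unique maximiser of `F`. -/
lemma tendsto_weighted_average_of_unique_max {F f : ℝ → ℝ} (hF : ContinuousOn F (Set.Icc 0 1))
    (hf : ContinuousOn f (Set.Icc 0 1)) {p : ℝ} (hp : p ∈ Set.Icc (0 : ℝ) 1)
    (hmax : ∀ q ∈ Set.Icc (0 : ℝ) 1, q ≠ p → F q < F p) {w : ℕ → ℕ → ℝ} {K : ℝ} {m : ℕ}
    (hpos : ∀ N i, 0 < N → i ≤ N → 0 < w N i)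
    (hw : ∀ N i, 0 < N → i ≤ N →
      |Real.log (w N i) - N * F (i / N)| ≤ K + m * Real.log (N + 1)) :
    Tendsto (fun N : ℕ => (∑ i ∈ range (N + 1), w N i * f (i / N)) / ∑ i ∈ range (N + 1), w N i)
      atTop (𝓝 (f p)) := by
  rw [Metric.tendsto_nhds]
  intro ε hε
  obtain ⟨η, hη, hfη⟩ := Metric.continuousOn_iff.1 hf p hp (ε / 2) (by positivity)
  obtain ⟨B, hB⟩ := isCompact_Icc.exists_bound_of_continuousOn (hf.sub continuousOn_const)
    (f := fun x => f x - f p)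
  have hB0 : 0 ≤ B := (norm_nonneg _).trans (hB p hp)
  obtain ⟨δ, hδ, hFδ⟩ : ∃ δ > 0, ∀ x ∈ Set.Icc (0 : ℝ) 1, η ≤ dist x p → F x ≤ F p - 3 * δ := by
    have hcomp : IsCompact (Set.Icc (0 : ℝ) 1 ∩ {x | η ≤ dist x p}) :=
      isCompact_Icc.inter_right (isClosed_le continuous_const (by fun_prop))
    rcases (Set.Icc (0 : ℝ) 1 ∩ {x | η ≤ dist x p}).eq_empty_or_nonempty with h | h
    · refine ⟨1, one_pos, fun x hx hxp => ?_⟩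
      exact absurd (show x ∈ Set.Icc (0 : ℝ) 1 ∩ {x | η ≤ dist x p} from ⟨hx, hxp⟩) (by simp [h])
    · obtain ⟨y, hy, hymax⟩ := hcomp.exists_isMaxOn h (hF.mono Set.inter_subset_left)
      have hyp : F y < F p := hmax y hy.1 fun h => by
        have := hy.2
        simp only [Set.mem_ofPred_eq, h, dist_self] at this
        linarith
      refine ⟨(F p - F y) / 3, by linarith, fun x hx hxp => ?_⟩
      have : F x ≤ F y := hymax ⟨hx, hxp⟩
      linarith
  have hfloor : ∀ N : ℕ, ⌊p * N⌋₊ ≤ N := fun N => Nat.floor_le_of_le (by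
    nlinarith [hp.2, (Nat.cast_nonneg N : (0 : ℝ) ≤ N)])
  have hunit : ∀ {N i : ℕ}, 0 < N → i ≤ N → (i : ℝ) / N ∈ Set.Icc (0 : ℝ) 1 := fun hN hi =>
    ⟨by positivity, (div_le_one (by exact_mod_cast hN)).2 (by exact_mod_cast hi)⟩
  have hnear : ∀ᶠ N : ℕ in atTop, F p - δ < F ((⌊p * N⌋₊ : ℝ) / N) := by
    have hlim : Tendsto (fun N : ℕ => (⌊p * N⌋₊ : ℝ) / N) atTop (𝓝[Set.Icc 0 1] p) := by
      refine tendsto_nhdsWithin_iff.2 ⟨(tendsto_nat_floor_mul_div_atTop hp.1).comp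
        tendsto_natCast_atTop_atTop, ?_⟩
      filter_upwards [eventually_gt_atTop 0] with N hN using hunit hN (hfloor N)
    exact ((hF p hp).tendsto.comp hlim).eventually_const_lt (by linarith)
  have hsmall : ∀ᶠ N : ℕ in atTop, B * Real.exp (2 * K) *
      (((N : ℝ) + 1) ^ (2 * m + 1) * Real.exp (-(2 * δ * N))) < ε / 2 := by
    have := (tendsto_pow_mul_exp_neg_mul_atTop (c := 2 * δ) (by positivity) (2 * m + 1)).const_mul
      (B * Real.exp (2 * K))
    rw [mul_zero] at this
    exact this.eventually_lt_const (by positivity)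
  filter_upwards [hnear, hsmall, eventually_gt_atTop 0] with N hnear hsmall hN
  set W := ∑ i ∈ range (N + 1), w N i with hW
  set j := ⌊p * N⌋₊
  have hj : j ≤ N := hfloor N
  have hwpos : ∀ i ∈ range (N + 1), 0 < w N i := fun i hi =>
    hpos N i hN (Nat.lt_succ_iff.1 (mem_range.1 hi))
  have hjW : w N j ≤ W :=
    single_le_sum (fun i hi => (hwpos i hi).le) (mem_range.2 (Nat.lt_succ_iff.2 hj))
  have hWpos : 0 < W := (hpos N j hN hj).trans_le hjW
  set E := Real.exp (2 * K) * (((N : ℝ) + 1) ^ (2 * m) * Real.exp (-(2 * δ * N))) with hE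
  have hEpos : 0 < E := by positivity
  have hlogE : Real.log E = 2 * (K + m * Real.log (N + 1)) - 2 * δ * N := by
    rw [hE, Real.log_mul (by positivity) (by positivity),
      Real.log_mul (by positivity) (by positivity), Real.log_pow, Real.log_exp, Real.log_exp]
    push_cast; ring
  have hfar : ∀ i ≤ N, η ≤ dist ((i : ℝ) / N) p → w N i ≤ W * E := by
    intro i hi hdist
    refine le_trans ?_ (mul_le_mul_of_nonneg_right hjW hEpos.le)
    rw [← Real.log_le_log_iff (hpos N i hN hi) (mul_pos (hpos N j hN hj) hEpos),
      Real.log_mul (hpos N j hN hj).ne' hEpos.ne', hlogE]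
    have h1 := (abs_le.1 (hw N i hN hi)).2
    have h2 := (abs_le.1 (hw N j hN hj)).1
    have h3 : (N : ℝ) * F (i / N) ≤ N * (F (j / N) - 2 * δ) := by
      have := hFδ _ (hunit hN hi) hdist
      gcongr
      linarith
    linarith
  have hterm : ∀ i ∈ range (N + 1),
      |w N i * (f (i / N) - f p)| ≤ w N i * (ε / 2) + B * (W * E) := by
    intro i hi
    have hiN := Nat.lt_succ_iff.1 (mem_range.1 hi)
    have hwi := hwpos i hi
    rw [abs_mul, abs_of_pos hwi]
    rcases lt_or_ge (dist ((i : ℝ) / N) p) η with h | h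
    · have h1 : |f (i / N) - f p| ≤ ε / 2 := (hfη _ (hunit hN hiN) h).le
      have : 0 ≤ B * (W * E) := by positivity
      nlinarith
    · have h1 : |f (i / N) - f p| ≤ B := hB _ (hunit hN hiN)
      calc w N i * |f (i / N) - f p| ≤ (W * E) * B := by gcongr; exact hfar i hiN h
        _ ≤ w N i * (ε / 2) + B * (W * E) := by nlinarith
  have hdiff : (∑ i ∈ range (N + 1), w N i * f (i / N)) / W - f p =
      (∑ i ∈ range (N + 1), w N i * (f (i / N) - f p)) / W := by
    simp only [mul_sub, sum_sub_distrib, ← sum_mul]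
    rw [← hW]
    field_simp
  rw [Real.dist_eq, hdiff, abs_div, abs_of_pos hWpos, div_lt_iff₀ hWpos]
  calc _ ≤ ∑ i ∈ range (N + 1), (w N i * (ε / 2) + B * (W * E)) :=
        (abs_sum_le_sum_abs _ _).trans (sum_le_sum hterm)
    _ = W * (ε / 2 + B * Real.exp (2 * K) *
          (((N : ℝ) + 1) ^ (2 * m + 1) * Real.exp (-(2 * δ * N)))) := by
        rw [sum_add_distrib, ← sum_mul, ← hW, sum_const, card_range, nsmul_eq_mul, hE]
        push_cast; ring
    _ < W * ε := by gcongr; linarith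
    _ = ε * W := mul_comm _ _

/-- Theorem 1.6: if `F` attains its maximum on `[0,1]` uniquely at `p*`, then
`lim_{N→∞} s(N;G) = 2p* - 1`. -/
theorem limit_speedG (G : ℝ → ℝ)
    (hGmap : ∀ x ∈ Set.Icc (0 : ℝ) 1, G x ∈ Set.Ioo (0 : ℝ) 1)
    (hGcont : ContinuousOn G (Set.Icc (0 : ℝ) 1))
    (hGmono : MonotoneOn G (Set.Icc (0 : ℝ) 1))
    (pstar : ℝ) (hmem : pstar ∈ Set.Icc (0 : ℝ) 1)
    (hmax : ∀ q ∈ Set.Icc (0 : ℝ) 1, q ≠ pstar → Ffun G q < Ffun G pstar) :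
    Tendsto (fun N => speedG N G) atTop (𝓝 (2 * pstar - 1)) := by
  have hsub : ∀ x ∈ Set.Icc (0 : ℝ) 1, 0 < 1 - G x := fun x hx => sub_pos.2 (hGmap x hx).2
  have hodds : ∀ x ∈ Set.Icc (0 : ℝ) 1, 0 < G x / (1 - G x) := fun x hx =>
    div_pos (hGmap x hx).1 (hsub x hx)
  set g : ℝ → ℝ := fun x => Real.log (G x / (1 - G x)) with hg
  have hgcont : ContinuousOn g (Set.Icc 0 1) :=
    (hGcont.div (continuousOn_const.sub hGcont) fun x hx => (hsub x hx).ne').log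
      fun x hx => (hodds x hx).ne'
  have hgmono : MonotoneOn g (Set.Icc 0 1) := fun x hx y hy hxy => by
    have := hGmono hx hy hxy
    refine Real.log_le_log (hodds x hx) ?_
    have h1 := hsub y hy
    have h2 := (hGmap y hy).1
    gcongr
  have hFcont : ContinuousOn (Ffun G) (Set.Icc 0 1) := by
    have hprim : ContinuousOn (fun p => ∫ x in (0 : ℝ)..p, g x) (Set.Icc 0 1) := by
      have := intervalIntegral.continuousOn_primitive_interval (a := (0 : ℝ)) (b := 1) (f := g)
        (μ := MeasureTheory.volume)
      rw [Set.uIcc_of_le zero_le_one] at this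
      exact this hgcont.integrableOn_Icc
    exact (hprim.sub Real.continuous_mul_log.continuousOn).sub
      (Real.continuous_mul_log.comp (continuous_const.sub continuous_id)).continuousOn
  have hunit : ∀ {N i : ℕ}, 0 < N → i ≤ N → (i : ℝ) / N ∈ Set.Icc (0 : ℝ) 1 := fun hN hi =>
    ⟨by positivity, (div_le_one (by exact_mod_cast hN)).2 (by exact_mod_cast hi)⟩
  have hprod : ∀ N i : ℕ,
      ∏ k ∈ Icc 1 i, G (((k : ℝ) - 1) / N) / (1 - G (((k : ℝ) - 1) / N)) =
        ∏ k ∈ range i, G ((k : ℝ) / N) / (1 - G ((k : ℝ) / N)) := fun N i => by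
    rw [← Finset.Ico_add_one_right_eq_Icc, Finset.prod_Ico_eq_prod_range]
    simp
  have hoddsN : ∀ {N i : ℕ}, 0 < N → i ≤ N → ∀ k ∈ range i,
      0 < G ((k : ℝ) / N) / (1 - G ((k : ℝ) / N)) := fun hN hi k hk =>
    hodds _ (hunit hN ((mem_range.1 hk).le.trans hi))
  have key := tendsto_weighted_average_of_unique_max (f := fun x => 2 * x - 1) hFcont
    (by fun_prop) hmem hmax (m := 3)
    (K := -Real.log (1 - G 1) + (g 1 - g 0) + 3)
    (w := fun N i => (1 / (1 - G ((i : ℝ) / N))) *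
      (∏ k ∈ Finset.Icc 1 i, G (((k : ℝ) - 1) / N) / (1 - G (((k : ℝ) - 1) / N))) *
      (N.choose i)) ?_ ?_
  · simpa only [speedG, mul_div_assoc] using key
  · intro N i hN hi
    have h1 := hsub _ (hunit hN hi)
    have h2 := prod_pos (hoddsN hN hi)
    have h3 : (0 : ℝ) < N.choose i := by exact_mod_cast Nat.choose_pos hi
    simp only [hprod]
    positivity
  · intro N i hN hi
    have h1 := hsub _ (hunit hN hi)
    have h2 := prod_pos (hoddsN hN hi)
    have h3 : (0 : ℝ) < N.choose i := by exact_mod_cast Nat.choose_pos hi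
    have hone : (1 : ℝ) ∈ Set.Icc (0 : ℝ) 1 := by simp
    have hbound : |-Real.log (1 - G ((i : ℝ) / N))| ≤ -Real.log (1 - G 1) := by
      have hle := hGmono (hunit hN hi) hone (hunit hN hi).2
      have := Real.log_le_log (hsub 1 hone) (sub_le_sub_left hle 1)
      have := Real.log_nonpos h1.le (by linarith [(hGmap _ (hunit hN hi)).1])
      rw [abs_of_nonneg] <;> linarith
    have hsum := abs_le.1 (hgmono.abs_sum_sub_integral_le hN hi)
    have hchoose := abs_le.1 (abs_log_choose_sub_le hN hi)
    have hbound := abs_le.1 hbound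
    simp only [hprod]
    rw [Real.log_mul (by positivity) h3.ne', Real.log_mul (by positivity) h2.ne',
      Real.log_prod fun k hk => (hoddsN hN hi k hk).ne', one_div, Real.log_inv, Ffun, abs_le]
    push_cast
    constructor <;> linarith [hsum.1, hsum.2, hchoose.1, hchoose.2]
end

section
/- Let l ≥ 1, let 0 < p_0 < ⋯ < p_l < 1, and let r_1 ≤ ⋯ ≤ r_l be reals in [0,1] with r_0 = 0 and r_{l+1} = 1. For i ∈ {0,…,l} define J_i = (1/( 2 p_i^{r_i} (1−p_i)^{1−r_i} )) ∏_{k=1}^{i} (p_{k−1}/(1−p_{k−1}))^{r_k − r_{k−1}} if r_i ≤ p_i ≤ r_{i+1}; J_i = (1/( 2 r_i^{r_i} (1−r_i)^{1−r_i} )) ∏_{k=1}^{i} (p_{k−1}/(1−p_{k−1}))^{r_k − r_{k−1}} if r_i > p_i; and J_i = (1/( 2 r_{i+1}^{r_{i+1}} (1−r_{i+1})^{1−r_{i+1}} )) (p_i/(1−p_i))^{r_{i+1} − r_i} ∏_{k=1}^{i} (p_{k−1}/(1−p_{k−1}))^{r_k − r_{k−1}} if r_{i+1} < p_i. Then every index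 i_0 at which max_{0 ≤ i ≤ l} J_i is attained satisfies r_{i_0} < p_{i_0} < r_{i_0+1}. -/
open Finset

/-- The exponential growth rate `J_i` of the `i`-th summand in the denominator of
the multi-stage speed formula, given by the three-case formula of (5.6):
the case `r_i ≤ p_i ≤ r_{i+1}`, the case `r_i > p_i`, and the case `r_{i+1} < p_i`. -/
noncomputable def Jcase (p r : ℕ → ℝ) (i : ℕ) : ℝ :=
  (∏ k ∈ Finset.Icc 1 i, (p (k - 1) / (1 - p (k - 1))) ^ (r k - r (k - 1))) *
    (if p i < r i then
      1 / (2 * r i ^ (r i) * (1 - r i) ^ (1 - r i))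
    else if r (i + 1) < p i then
      (1 / (2 * r (i + 1) ^ (r (i + 1)) * (1 - r (i + 1)) ^ (1 - r (i + 1)))) *
        (p i / (1 - p i)) ^ (r (i + 1) - r i)
    else
      1 / (2 * p i ^ (r i) * (1 - p i) ^ (1 - r i)))

/-- The log-odds of `q`. -/
noncomputable def logOdds (q : ℝ) : ℝ := Real.log q - Real.log (1 - q)

/-- The cross entropy of Bernoulli laws with parameters `x` and `q`. -/
noncomputable def crossEntropy (q x : ℝ) : ℝ := -(x * Real.log q + (1 - x) * Real.log (1 - q))

/-- The logarithm of the product in `Jcase`. -/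
noncomputable def logOddsSum (p r : ℕ → ℝ) (i : ℕ) : ℝ :=
  ∑ k ∈ range i, logOdds (p k) * (r (k + 1) - r k)

/-- The logarithm of twice the last factor in `Jcase`. -/
noncomputable def stageEntropy (q a b : ℝ) : ℝ :=
  if q < a then Real.binEntropy a
  else if b < q then Real.binEntropy b + logOdds q * (b - a)
  else crossEntropy q a

lemma logOddsSum_succ (p r : ℕ → ℝ) (i : ℕ) :
    logOddsSum p r (i + 1) = logOddsSum p r i + logOdds (p i) * (r (i + 1) - r i) :=
  sum_range_succ _ _

lemma logOdds_lt_logOdds {q s : ℝ} (hq : 0 < q) (hqs : q < s) (hs : s < 1) :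
    logOdds q < logOdds s := by
  have h₁ := Real.log_lt_log hq hqs
  have h₂ := Real.log_lt_log (show 0 < 1 - s by linarith) (show 1 - s < 1 - q by linarith)
  unfold logOdds
  linarith

lemma crossEntropy_self (q : ℝ) : crossEntropy q q = Real.binEntropy q := by
  simp only [crossEntropy, Real.binEntropy, Real.log_inv]
  ring

lemma crossEntropy_eq_add (q a b : ℝ) :
    crossEntropy q a = crossEntropy q b + logOdds q * (b - a) := by
  unfold crossEntropy logOdds
  ring

lemma mul_log_sub_mul_log_lt {q x : ℝ} (hq : 0 < q) (hx : 0 ≤ x) (hne : x ≠ q) :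
    x * Real.log q - x * Real.log x < q - x := by
  rcases hx.eq_or_lt with rfl | hx
  · simpa using hq
  · have h := Real.log_lt_sub_one_of_pos (div_pos hq hx) (by
      rw [Ne, div_eq_one_iff_eq hx.ne']
      exact hne.symm)
    rw [Real.log_div hq.ne' hx.ne'] at h
    have h₂ := mul_lt_mul_of_pos_left h hx
    have h₃ : x * (q / x - 1) = q - x := by field_simp
    linarith

/-- Gibbs' inequality for Bernoulli laws. -/
lemma binEntropy_lt_crossEntropy {q x : ℝ} (hq : q ∈ Set.Ioo (0 : ℝ) 1)
    (hx : x ∈ Set.Icc (0 : ℝ) 1) (hne : x ≠ q) : Real.binEntropy x < crossEntropy q x := by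
  have h₁ := mul_log_sub_mul_log_lt hq.1 hx.1 hne
  have h₂ := mul_log_sub_mul_log_lt (q := 1 - q) (x := 1 - x) (by linarith [hq.2])
    (by linarith [hx.2]) (fun h => hne (by linarith))
  simp only [crossEntropy, Real.binEntropy, Real.log_inv]
  linarith

lemma stageEntropy_of_le_left {q a b : ℝ} (hab : a ≤ b) (h : q ≤ a) :
    stageEntropy q a b = Real.binEntropy a := by
  unfold stageEntropy
  rcases h.eq_or_lt with rfl | h
  · simp [hab.not_gt, crossEntropy_self]
  · simp [h]

lemma stageEntropy_of_right_le {q a b : ℝ} (hab : a ≤ b) (h : b ≤ q) :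
    stageEntropy q a b = Real.binEntropy b + logOdds q * (b - a) := by
  unfold stageEntropy
  rw [if_neg (hab.trans h).not_gt]
  rcases h.eq_or_lt with rfl | h
  · rw [if_neg (lt_irrefl _), crossEntropy_eq_add b a b, crossEntropy_self]
  · rw [if_pos h]

lemma lt_stageEntropy_of_lt_right {q a b : ℝ} (hq : q ∈ Set.Ioo (0 : ℝ) 1)
    (hab : a < b) (hb : b ≤ 1) (h : q < b) :
    Real.binEntropy b + logOdds q * (b - a) < stageEntropy q a b := by
  have hbI : b ∈ Set.Icc (0 : ℝ) 1 := ⟨(hq.1.trans h).le, hb⟩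
  unfold stageEntropy
  split_ifs with h₁ h₂
  · have hg := binEntropy_lt_crossEntropy ⟨hq.1.trans h₁, hab.trans_le hb⟩ hbI hab.ne'
    have hc := crossEntropy_eq_add a a b
    rw [crossEntropy_self] at hc
    have hm := mul_lt_mul_of_pos_right (logOdds_lt_logOdds hq.1 h₁ (hab.trans_le hb))
      (sub_pos.2 hab)
    linarith
  · exact absurd h₂ h.not_gt
  · rw [crossEntropy_eq_add q a b]
    linarith [binEntropy_lt_crossEntropy hq hbI h.ne']

lemma lt_stageEntropy_of_left_lt {q a b : ℝ} (hq : q ∈ Set.Ioo (0 : ℝ) 1)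
    (hab : a < b) (ha : 0 ≤ a) (h : a < q) :
    Real.binEntropy a < stageEntropy q a b := by
  have haI : a ∈ Set.Icc (0 : ℝ) 1 := ⟨ha, (h.trans hq.2).le⟩
  unfold stageEntropy
  rw [if_neg h.not_gt]
  split_ifs with h₂
  · have hg := binEntropy_lt_crossEntropy ⟨ha.trans_lt hab, h₂.trans hq.2⟩ haI hab.ne
    rw [crossEntropy_eq_add b a b, crossEntropy_self] at hg
    have hm := mul_lt_mul_of_pos_right (logOdds_lt_logOdds (ha.trans_lt hab) h₂ hq.2)
      (sub_pos.2 hab)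
    linarith
  · exact binEntropy_lt_crossEntropy hq haI h.ne

lemma odds_rpow_eq_exp {q : ℝ} (hq : q ∈ Set.Ioo (0 : ℝ) 1) (y : ℝ) :
    (q / (1 - q)) ^ y = Real.exp (logOdds q * y) := by
  have h : 0 < 1 - q := sub_pos.2 hq.2
  rw [Real.rpow_def_of_pos (div_pos hq.1 h), Real.log_div hq.1.ne' h.ne', logOdds]

lemma rpow_self_eq_exp {x : ℝ} (hx : 0 ≤ x) : x ^ x = Real.exp (x * Real.log x) := by
  rcases hx.eq_or_lt with rfl | hx
  · simp
  · rw [Real.rpow_def_of_pos hx, mul_comm]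

lemma one_div_two_mul_rpow_self {x : ℝ} (hx : x ∈ Set.Icc (0 : ℝ) 1) :
    1 / (2 * x ^ x * (1 - x) ^ (1 - x)) = Real.exp (Real.binEntropy x) / 2 := by
  rw [rpow_self_eq_exp hx.1, rpow_self_eq_exp (sub_nonneg.2 hx.2), mul_assoc, ← Real.exp_add,
    ← crossEntropy_self, crossEntropy, Real.exp_neg]
  field_simp

lemma one_div_two_mul_rpow {q : ℝ} (hq : q ∈ Set.Ioo (0 : ℝ) 1) (x : ℝ) :
    1 / (2 * q ^ x * (1 - q) ^ (1 - x)) = Real.exp (crossEntropy q x) / 2 := by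
  rw [Real.rpow_def_of_pos hq.1, Real.rpow_def_of_pos (sub_pos.2 hq.2), mul_assoc,
    ← Real.exp_add, crossEntropy, Real.exp_neg, mul_comm x, mul_comm (1 - x)]
  field_simp

lemma prod_odds_rpow_eq_exp (p r : ℕ → ℝ) (i : ℕ) (hp : ∀ k < i, p k ∈ Set.Ioo (0 : ℝ) 1) :
    ∏ k ∈ Icc 1 i, (p (k - 1) / (1 - p (k - 1))) ^ (r k - r (k - 1)) =
      Real.exp (logOddsSum p r i) := by
  induction i with
  | zero => simp [logOddsSum]
  | succ n ih =>
    rw [prod_Icc_succ_top (by omega), ih fun k hk => hp k (by omega), logOddsSum_succ,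
      Real.exp_add, Nat.add_sub_cancel, odds_rpow_eq_exp (hp n n.lt_succ_self)]

lemma Jcase_eq_exp (p r : ℕ → ℝ) (i : ℕ) (hp : ∀ k ≤ i, p k ∈ Set.Ioo (0 : ℝ) 1)
    (hr : r i ∈ Set.Icc (0 : ℝ) 1) (hr' : r (i + 1) ∈ Set.Icc (0 : ℝ) 1) :
    Jcase p r i =
      Real.exp (logOddsSum p r i + stageEntropy (p i) (r i) (r (i + 1))) / 2 := by
  rw [Jcase, prod_odds_rpow_eq_exp p r i fun k hk => hp k hk.le, stageEntropy, Real.exp_add,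
    mul_div_assoc]
  congr 1
  split_ifs
  · exact one_div_two_mul_rpow_self hr
  · rw [one_div_two_mul_rpow_self hr', odds_rpow_eq_exp (hp i le_rfl), Real.exp_add]
    ring
  · exact one_div_two_mul_rpow (hp i le_rfl) _

lemma exists_last_increase (p r : ℕ → ℝ) (i : ℕ) (hmono : ∀ k < i, r k ≤ r (k + 1))
    (hi : r 0 < r i) :
    ∃ j < i, r j < r (j + 1) ∧ r (j + 1) = r i ∧ logOddsSum p r (j + 1) = logOddsSum p r i := by
  induction i with
  | zero => exact absurd hi (lt_irrefl _)
  | succ n ih =>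
    rcases (hmono n n.lt_succ_self).lt_or_eq with h | h
    · exact ⟨n, n.lt_succ_self, h, rfl, rfl⟩
    · obtain ⟨j, hj, h₁, h₂, h₃⟩ := ih (fun k hk => hmono k (by omega)) (h ▸ hi)
      refine ⟨j, by omega, h₁, h₂.trans h, ?_⟩
      rw [h₃, logOddsSum_succ, h]
      ring

lemma exists_next_increase (p r : ℕ → ℝ) (i d : ℕ)
    (hmono : ∀ k, i ≤ k → k < i + d → r k ≤ r (k + 1)) (hi : r i < r (i + d)) :
    ∃ j, i ≤ j ∧ j < i + d ∧ r j < r (j + 1) ∧ r j = r i ∧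
      logOddsSum p r j = logOddsSum p r i := by
  induction d generalizing i with
  | zero => exact absurd hi (lt_irrefl _)
  | succ n ih =>
    rcases (hmono i le_rfl (by omega)).lt_or_eq with h | h
    · exact ⟨i, le_rfl, by omega, h, rfl, rfl⟩
    · obtain ⟨j, hj, hj', h₁, h₂, h₃⟩ := ih (i + 1) (fun k _ _ => hmono k (by omega) (by omega))
        (by rw [← h, add_assoc, add_comm 1 n]; exact hi)
      refine ⟨j, by omega, by omega, h₁, h₂.trans h.symm, ?_⟩
      rw [h₃, logOddsSum_succ, h]
      ring

/-- Any index `i₀` at which `max_{0 ≤ i ≤ l} J_i` is attained satisfies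
`r_{i₀} < p_{i₀} < r_{i₀+1}`. -/
theorem argmax_J_is_interior (l : ℕ) (hl : 1 ≤ l)
    (p : ℕ → ℝ) (hp0 : 0 < p 0) (hpmono : ∀ i < l, p i < p (i + 1)) (hpl : p l < 1)
    (r : ℕ → ℝ) (hr0 : r 0 = 0) (hrtop : r (l + 1) = 1)
    (hrmem : ∀ i, 1 ≤ i → i ≤ l → r i ∈ Set.Icc (0 : ℝ) 1)
    (hrmono : ∀ i, 1 ≤ i → i < l → r i ≤ r (i + 1))
    (i0 : ℕ) (hi0 : i0 ≤ l) (hmax : ∀ i ≤ l, Jcase p r i ≤ Jcase p r i0) :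
    r i0 < p i0 ∧ p i0 < r (i0 + 1) := by
  have hmono : ∀ i ≤ l, r i ≤ r (i + 1) := by
    intro i hi
    rcases Nat.eq_zero_or_pos i with rfl | hpos
    · rw [hr0]
      exact (hrmem 1 le_rfl hl).1
    rcases hi.eq_or_lt with rfl | hlt
    · rw [hrtop]
      exact (hrmem i hpos le_rfl).2
    · exact hrmono i hpos hlt
  have hmem : ∀ i ≤ l + 1, r i ∈ Set.Icc (0 : ℝ) 1 := by
    intro i hi
    rcases Nat.eq_zero_or_pos i with rfl | hpos
    · simp [hr0]
    rcases hi.eq_or_lt with rfl | hlt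
    · simp [hrtop]
    · exact hrmem i hpos (by omega)
  have hplt : ∀ j ≤ l, ∀ i < j, p i < p j := by
    intro j
    induction j with
    | zero => intro _ i hi; omega
    | succ n ih =>
      intro hn i hi
      have hstep := hpmono n (by omega)
      rcases (Nat.lt_succ_iff.1 hi).eq_or_lt with rfl | hlt
      · exact hstep
      · exact (ih (by omega) i hlt).trans hstep
  have hpI : ∀ i ≤ l, p i ∈ Set.Ioo (0 : ℝ) 1 := by
    intro i hi
    constructor
    · rcases Nat.eq_zero_or_pos i with rfl | hpos
      · exact hp0
      · exact hp0.trans (hplt i hi 0 hpos)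
    · rcases hi.eq_or_lt with rfl | hlt
      · exact hpl
      · exact (hplt l le_rfl i hlt).trans hpl
  have hle : ∀ j ≤ l, logOddsSum p r j + stageEntropy (p j) (r j) (r (j + 1)) ≤
      logOddsSum p r i0 + stageEntropy (p i0) (r i0) (r (i0 + 1)) := by
    intro j hj
    have h := hmax j hj
    rw [Jcase_eq_exp p r j (fun k hk => hpI k (hk.trans hj)) (hmem j (by omega))
        (hmem _ (by omega)),
      Jcase_eq_exp p r i0 (fun k hk => hpI k (hk.trans hi0)) (hmem i0 (by omega))
        (hmem _ (by omega))] at h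
    exact Real.exp_le_exp.1 ((div_le_div_iff_of_pos_right two_pos).1 h)
  constructor
  · by_contra! h
    obtain ⟨j, hj, hlt, heq, hS⟩ := exists_last_increase p r i0
      (fun k hk => hmono k (by omega)) (by linarith [(hpI i0 hi0).1])
    have hb := lt_stageEntropy_of_lt_right (hpI j (by omega)) hlt (hmem (j + 1) (by omega)).2
      (by linarith [hplt i0 hi0 j hj])
    have hj' := hle j (by omega)
    rw [stageEntropy_of_le_left (hmono i0 hi0) h, ← hS, logOddsSum_succ, ← heq] at hj'
    linarith
  · by_contra! h
    have htop : i0 + 1 + (l - i0) = l + 1 := by omega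
    obtain ⟨j, hj, hjl, hlt, heq, hS⟩ := exists_next_increase p r (i0 + 1) (l - i0)
      (fun k _ _ => hmono k (by omega)) (by rw [htop, hrtop]; linarith [(hpI i0 hi0).2])
    have hb := lt_stageEntropy_of_left_lt (hpI j (by omega)) hlt (hmem j (by omega)).1
      (by linarith [hplt j (by omega) i0 (by omega)])
    have hj' := hle j (by omega)
    rw [stageEntropy_of_right_le (hmono i0 hi0) h, hS, logOddsSum_succ, ← heq] at hj'
    linarith
end

section
/- Let l ≥ 1, let 0 < p_0 < p_1 < ⋯ < p_l < 1, and let r_1 ≤ ⋯ ≤ r_l be reals in [0,1] with r_0 = 0 and r_{l+1} = 1. Then there exists at least one index i ∈ {0,…,l} with r_i < p_i < r_{i+1}. -/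
/-- With `r₀ = 0`, `r_{l+1} = 1`, `r₁ ≤ ⋯ ≤ r_l` in `[0,1]` and
`0 < p₀ < ⋯ < p_l < 1`, there is at least one index `i ∈ {0,…,l}` with
`r_i < p_i < r_{i+1}`. -/
theorem exists_interior_index (l : ℕ) (hl : 1 ≤ l)
    (p : ℕ → ℝ) (hp0 : 0 < p 0) (hpmono : ∀ i < l, p i < p (i + 1)) (hpl : p l < 1)
    (r : ℕ → ℝ) (hr0 : r 0 = 0) (hrtop : r (l + 1) = 1)
    (hrmem : ∀ i, 1 ≤ i → i ≤ l → r i ∈ Set.Icc (0 : ℝ) 1)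
    (hrmono : ∀ i, 1 ≤ i → i < l → r i ≤ r (i + 1)) :
    ∃ i ≤ l, r i < p i ∧ p i < r (i + 1) := by
  by_contra! h
  have key : ∀ i ≤ l, r i < p i := by
    intro i
    induction i with
    | zero => intro _; rwa [hr0]
    | succ k ih =>
      intro hk
      exact (h k (by lia) (ih (by lia))).trans_lt (hpmono k hk)
  have := h l le_rfl (key l le_rfl)
  linarith
end

section
/- Let 0 < p < 1 and let M_N, M'_N be integer sequences with 0 ≤ M_N < M'_N ≤ N + 1 such that M_N/N → a and M'_N/N → b with a < p < b. Then lim_{N→∞} [ Σ_{j=M_N}^{M'_N − 1} (2j/N − 1) C(N,j) (p/(1−p))^{j − M_N} ] / [ Σ_{j=M_N}^{M'_N − 1} C(N,j) (p/(1−p))^{j − M_N} ] = 2p − 1. -/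
open Filter Finset Topology

/-- The probability that a binomial variable with parameters `n` and `p` equals `j`. -/
noncomputable def binomialWeight (p : ℝ) (n j : ℕ) : ℝ :=
  (n.choose j : ℝ) * p ^ j * (1 - p) ^ (n - j)

theorem binomialWeight_eq_eval (p : ℝ) (n j : ℕ) :
    binomialWeight p n j = (bernsteinPolynomial ℝ n j).eval p := by
  simp [binomialWeight, bernsteinPolynomial]

theorem binomialWeight_nonneg {p : ℝ} (hp0 : 0 ≤ p) (hp1 : p ≤ 1) (n j : ℕ) :
    0 ≤ binomialWeight p n j := by
  have := sub_nonneg.2 hp1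
  unfold binomialWeight
  positivity

theorem sum_binomialWeight (p : ℝ) (n : ℕ) :
    ∑ j ∈ range (n + 1), binomialWeight p n j = 1 := by
  have h := congrArg (Polynomial.eval p) (bernsteinPolynomial.sum ℝ n)
  simpa [Polynomial.eval_finsetSum, ← binomialWeight_eq_eval] using h

theorem sum_sq_mul_binomialWeight (p : ℝ) (n : ℕ) :
    ∑ j ∈ range (n + 1), (n * p - j) ^ 2 * binomialWeight p n j = n * p * (1 - p) := by
  have h := congrArg (Polynomial.eval p) (bernsteinPolynomial.variance ℝ n)
  simpa [Polynomial.eval_finsetSum, ← binomialWeight_eq_eval] using h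

/-- Chebyshev's inequality for the binomial distribution. -/
theorem one_sub_le_sum_Ico_binomialWeight {p δ : ℝ} (hp0 : 0 ≤ p) (hp1 : p ≤ 1) (hδ : 0 < δ)
    {n m m' : ℕ} (hn : 0 < n) (hm : (m : ℝ) ≤ n * (p - δ)) (hm' : n * (p + δ) ≤ (m' : ℝ))
    (hm'n : m' ≤ n + 1) :
    1 - p * (1 - p) / (n * δ ^ 2) ≤ ∑ j ∈ Ico m m', binomialWeight p n j := by
  have hn' : (0 : ℝ) < n := Nat.cast_pos.2 hn
  have hsub : Ico m m' ⊆ range (n + 1) := fun j hj => by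
    simp only [mem_Ico, mem_range] at hj ⊢
    omega
  have hsplit := sum_sdiff (f := binomialWeight p n) hsub
  rw [sum_binomialWeight] at hsplit
  have htail : (n * δ) ^ 2 * ∑ j ∈ range (n + 1) \ Ico m m', binomialWeight p n j
      ≤ n * p * (1 - p) := by
    rw [← sum_sq_mul_binomialWeight, mul_sum]
    refine (sum_le_sum fun j hj => ?_).trans (sum_le_sum_of_subset_of_nonneg sdiff_subset
      fun j _ _ => mul_nonneg (sq_nonneg _) (binomialWeight_nonneg hp0 hp1 n j))
    refine mul_le_mul_of_nonneg_right ?_ (binomialWeight_nonneg hp0 hp1 n j)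
    have hnδ : 0 < n * δ := mul_pos hn' hδ
    rw [sq_le_sq, abs_of_pos hnδ, le_abs]
    rw [Finset.mem_sdiff, Finset.mem_Ico, not_and_or, not_le, not_lt] at hj
    rcases hj.2 with h | h
    · left
      have : (j : ℝ) < m := Nat.cast_lt.2 h
      linarith
    · right
      have : (m' : ℝ) ≤ j := Nat.cast_le.2 h
      linarith
  have hdiv : ∑ j ∈ range (n + 1) \ Ico m m', binomialWeight p n j
      ≤ p * (1 - p) / (n * δ ^ 2) := by
    rw [le_div_iff₀ (by positivity)]
    refine le_of_mul_le_mul_left ?_ hn'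
    linarith
  linarith

/-- By the Cauchy–Schwarz inequality, the mean of `2 j / n - 1` over a window of the binomial
distribution is close to `2 p - 1` as soon as the window carries enough mass. -/
theorem sq_sum_Ico_mul_binomialWeight_le {p : ℝ} (hp0 : 0 ≤ p) (hp1 : p ≤ 1)
    {n m m' : ℕ} (hn : 0 < n) (hm'n : m' ≤ n + 1) :
    (∑ j ∈ Ico m m', (2 * (j : ℝ) / n - 1) * binomialWeight p n j
        - (2 * p - 1) * ∑ j ∈ Ico m m', binomialWeight p n j) ^ 2
      ≤ 4 * p * (1 - p) / n * ∑ j ∈ Ico m m', binomialWeight p n j := by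
  have hn' : (0 : ℝ) < n := Nat.cast_pos.2 hn
  have hw := binomialWeight_nonneg hp0 hp1 n
  have hsub : Ico m m' ⊆ range (n + 1) := fun j hj => by
    simp only [mem_Ico, mem_range] at hj ⊢
    omega
  have hvar : ∑ j ∈ Ico m m', (2 * (j : ℝ) / n - 2 * p) ^ 2 * binomialWeight p n j
      ≤ 4 * p * (1 - p) / n := by
    calc _ ≤ ∑ j ∈ range (n + 1), (2 * (j : ℝ) / n - 2 * p) ^ 2 * binomialWeight p n j :=
          sum_le_sum_of_subset_of_nonneg hsub fun j _ _ => mul_nonneg (sq_nonneg _) (hw j)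
      _ = 4 / (n : ℝ) ^ 2 * ∑ j ∈ range (n + 1), (n * p - j) ^ 2 * binomialWeight p n j := by
          rw [mul_sum]
          refine sum_congr rfl fun j _ => ?_
          field_simp
          ring
      _ = 4 * p * (1 - p) / n := by
          rw [sum_sq_mul_binomialWeight]
          field_simp
  have hdiff : ∑ j ∈ Ico m m', (2 * (j : ℝ) / n - 1) * binomialWeight p n j
        - (2 * p - 1) * ∑ j ∈ Ico m m', binomialWeight p n j
      = ∑ j ∈ Ico m m', (2 * (j : ℝ) / n - 2 * p) * binomialWeight p n j := by
    rw [mul_sum, ← sum_sub_distrib]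
    exact sum_congr rfl fun j _ => by ring
  rw [hdiff]
  refine (sum_sq_le_sum_mul_sum_of_sq_le_mul (Ico m m')
    (fun j _ => mul_nonneg (sq_nonneg (2 * (j : ℝ) / n - 2 * p)) (hw j)) (fun j _ => hw j)
    fun j _ => le_of_eq (by ring)).trans ?_
  exact mul_le_mul_of_nonneg_right hvar (sum_nonneg fun j _ => hw j)

/-- Up to a factor independent of `j`, the weights `C(n,j) (p / (1 - p)) ^ (j - m)` are
binomial probabilities. -/
theorem choose_mul_pow_sub_eq {p : ℝ} (hp0 : 0 < p) (hp1 : p < 1) {n m j : ℕ}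
    (hmj : m ≤ j) (hjn : j ≤ n) :
    (n.choose j : ℝ) * (p / (1 - p)) ^ (j - m)
      = ((p / (1 - p)) ^ m * (1 - p) ^ n)⁻¹ * binomialWeight p n j := by
  have hq : (1 - p) ≠ 0 := (sub_pos.2 hp1).ne'
  obtain ⟨k, rfl⟩ := Nat.exists_eq_add_of_le hmj
  obtain ⟨l, rfl⟩ := Nat.exists_eq_add_of_le hjn
  rw [binomialWeight, Nat.add_sub_cancel_left, Nat.add_sub_cancel_left, div_pow, div_pow]
  field_simp
  ring

theorem sum_choose_mul_pow_div_eq {p : ℝ} (hp0 : 0 < p) (hp1 : p < 1) (f : ℕ → ℝ)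
    {n m m' : ℕ} (hm'n : m' ≤ n + 1) :
    (∑ j ∈ Ico m m', f j * (n.choose j : ℝ) * (p / (1 - p)) ^ (j - m)) /
        (∑ j ∈ Ico m m', (n.choose j : ℝ) * (p / (1 - p)) ^ (j - m))
      = (∑ j ∈ Ico m m', f j * binomialWeight p n j) /
        ∑ j ∈ Ico m m', binomialWeight p n j := by
  have hq : 0 < 1 - p := sub_pos.2 hp1
  have hc : ((p / (1 - p)) ^ m * (1 - p) ^ n)⁻¹ ≠ 0 := by positivity
  have hterm : ∀ j ∈ Ico m m', (n.choose j : ℝ) * (p / (1 - p)) ^ (j - m)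
      = ((p / (1 - p)) ^ m * (1 - p) ^ n)⁻¹ * binomialWeight p n j := fun j hj => by
    rw [mem_Ico] at hj
    exact choose_mul_pow_sub_eq hp0 hp1 hj.1 (by omega)
  rw [← mul_div_mul_left _ (∑ j ∈ Ico m m', binomialWeight p n j) hc, mul_sum, mul_sum]
  congr 1
  · refine sum_congr rfl fun j hj => ?_
    rw [mul_assoc, hterm j hj]
    ring
  · exact sum_congr rfl hterm

/-- Equation (5.8): if `M_N/N → a` and `M'_N/N → b` with `a < p < b`, then
`(∑_{j=M_N}^{M'_N-1} (2j/N-1) C(N,j) (p/(1-p))^{j-M_N}) /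
 (∑_{j=M_N}^{M'_N-1} C(N,j) (p/(1-p))^{j-M_N}) → 2p - 1`. -/
theorem binomial_sum_ratio_limit (p a b : ℝ) (hp0 : 0 < p) (hp1 : p < 1)
    (hap : a < p) (hpb : p < b)
    (M M' : ℕ → ℕ) (hMM : ∀ N, M N < M' N ∧ M' N ≤ N + 1)
    (hMa : Tendsto (fun N => (M N : ℝ) / N) atTop (𝓝 a))
    (hMb : Tendsto (fun N => (M' N : ℝ) / N) atTop (𝓝 b)) :
    Tendsto (fun N : ℕ =>
        (∑ j ∈ Finset.Ico (M N) (M' N),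
          (2 * (j : ℝ) / N - 1) * (N.choose j : ℝ) * (p / (1 - p)) ^ (j - M N)) /
        (∑ j ∈ Finset.Ico (M N) (M' N),
          (N.choose j : ℝ) * (p / (1 - p)) ^ (j - M N)))
      atTop (𝓝 (2 * p - 1)) := by
  set δ := min (p - a) (b - p) / 2 with hδ_def
  have hδ : 0 < δ := half_pos (lt_min (sub_pos.2 hap) (sub_pos.2 hpb))
  have hδa : a < p - δ := by linarith [min_le_left (p - a) (b - p)]
  have hδb : p + δ < b := by linarith [min_le_right (p - a) (b - p)]
  have hmass : Tendsto (fun N : ℕ => p * (1 - p) / δ ^ 2 / (N : ℝ)) atTop (𝓝 0) :=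
    tendsto_const_div_atTop_nhds_zero_nat _
  have hbound : Tendsto (fun N : ℕ => √(8 * p * (1 - p) / (N : ℝ))) atTop (𝓝 0) := by
    simpa using (tendsto_const_div_atTop_nhds_zero_nat (8 * p * (1 - p))).sqrt
  rw [tendsto_iff_norm_sub_tendsto_zero]
  refine squeeze_zero' (Eventually.of_forall fun N => norm_nonneg _) ?_ hbound
  filter_upwards [hMa.eventually_lt_const hδa, hMb.eventually_const_lt hδb,
    hmass.eventually_lt_const one_half_pos, eventually_gt_atTop 0] with N hNa hNb hNδ hN
  have hN' : (0 : ℝ) < N := Nat.cast_pos.2 hN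
  rw [div_lt_iff₀ hN'] at hNa
  rw [lt_div_iff₀ hN'] at hNb
  rw [sum_choose_mul_pow_div_eq hp0 hp1 (fun j : ℕ => 2 * (j : ℝ) / N - 1) (hMM N).2]
  have hD := one_sub_le_sum_Ico_binomialWeight hp0.le hp1.le hδ hN
    (by linarith : (M N : ℝ) ≤ N * (p - δ)) (by linarith) (hMM N).2
  have hE := sq_sum_Ico_mul_binomialWeight_le hp0.le hp1.le (m := M N) hN (hMM N).2
  rw [mul_comm (N : ℝ), ← div_div] at hD
  set D := ∑ j ∈ Ico (M N) (M' N), binomialWeight p N j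
  have hD_half : 1 / 2 ≤ D := by linarith
  have hD_pos : 0 < D := by linarith
  refine Real.abs_le_sqrt ?_
  rw [div_sub' hD_pos.ne', div_pow, div_le_iff₀ (by positivity), mul_comm D]
  refine hE.trans ?_
  have hvar : 0 ≤ 4 * p * (1 - p) / N := by
    have := sub_pos.2 hp1
    positivity
  calc 4 * p * (1 - p) / N * D ≤ 4 * p * (1 - p) / N * (2 * D ^ 2) :=
        mul_le_mul_of_nonneg_left (by nlinarith) hvar
    _ = 8 * p * (1 - p) / N * D ^ 2 := by ring
end
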